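/- arXiv:2511.08524 — 7 statements merged into one kernel-verified Lean document; each statement's English description precedes it below -/
import Mathlib

section
/- Let μ_n be the probability measure on ℝ² given by μ_n = ∑_{h=1}^{n} ∑_{i=0}^{n−h} (N(n,h,i)/D(n))·δ_{(h/√(2n), i/n)}. Then μ_n converges weakly as n → ∞ to the probability measure on ℝ² supported on (0,∞)×(0,1) with density ρ(x,y) = (2^{1/4}/(Γ(3/4)·√π))·x^{3/2}·(y(1−y))^{−3/2}·exp(−x²/(2y(1−y))) with respect to Lebesgue measure. (This is the scaling limit of the joint law of the rescaled cycle length and external area of a uniform pointed well-labelled unicycle.) -/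
open Filter MeasureTheory

/-- The central trinomial coefficient `t_k`: the number of sequences
`(s_1, …, s_k) ∈ {-1,0,1}^k` with `s_1 + ⋯ + s_k = 0`. -/
def trinom (k : ℕ) : ℕ :=
  (Finset.univ.filter (fun s : Fin k → Fin 3 => (∑ i, ((s i : ℤ) - 1)) = 0)).card

/-- `F(a,b) = (a/(a+2b)) C(a+2b, b)`, the number of plane forests with `a` trees
and `b` edges. -/
noncomputable def Fforest (a b : ℕ) : ℝ :=
  ((a : ℝ) / ((a : ℝ) + 2 * b)) * (Nat.choose (a + 2 * b) b : ℝ)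

/-- `N(n,h,i) = 3^{n-h} t_h F(h,i) F(h, n-h-i)`, the number of pointed
well-labelled unicycles with `n` edges, cycle length `h` and external area `i`. -/
noncomputable def Ncount (n h i : ℕ) : ℝ :=
  (3 : ℝ) ^ (n - h) * (trinom h : ℝ) * Fforest h i * Fforest h (n - h - i)

/-- `D(n) = ∑_{h=1}^n ∑_{i=0}^{n-h} N(n,h,i)`. -/
noncomputable def Dcount (n : ℕ) : ℝ :=
  ∑ h ∈ Finset.Icc 1 n, ∑ i ∈ Finset.range (n - h + 1), Ncount n h i

/-- The empirical measure `μ_n = ∑_{h=1}^n ∑_{i=0}^{n-h} (N(n,h,i)/D(n)) δ_{(h/√(2n), i/n)}`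
on `ℝ²`. -/
noncomputable def muN (n : ℕ) : Measure (ℝ × ℝ) :=
  ∑ h ∈ Finset.Icc 1 n, ∑ i ∈ Finset.range (n - h + 1),
    (ENNReal.ofReal (Ncount n h i / Dcount n)) •
      Measure.dirac (((h : ℝ) / Real.sqrt (2 * n), (i : ℝ) / n) : ℝ × ℝ)

/-- The limiting density `ρ(x,y)` on `(0,∞) × (0,1)`. -/
noncomputable def rhoLim (p : ℝ × ℝ) : ℝ :=
  (2 : ℝ) ^ ((1 : ℝ) / 4) / (Real.Gamma (3 / 4) * Real.sqrt Real.pi) *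
    p.1 ^ ((3 : ℝ) / 2) * (p.2 * (1 - p.2)) ^ (-(3 : ℝ) / 2) *
    Real.exp (-(p.1 ^ 2) / (2 * (p.2 * (1 - p.2))))

/-- The limiting measure: `ρ(x,y)` times Lebesgue measure on `(0,∞) × (0,1)`. -/
noncomputable def muLim : Measure (ℝ × ℝ) :=
  (volume.restrict (Set.Ioi (0 : ℝ) ×ˢ Set.Ioo (0 : ℝ) 1)).withDensity
    (fun p => ENNReal.ofReal (rhoLim p))


/-- The real characteristic function of the lazy walk with step law
`(1 - r) δ₀ + (r / 2) (δ_a + δ_{-a})`. -/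
noncomputable def lazyCos (r a θ : ℝ) : ℝ := 1 + r * (Real.cos (a * θ) - 1)

lemma continuous_lazyCos (r a : ℝ) : Continuous (lazyCos r a) := by
  unfold lazyCos; fun_prop

lemma tendsto_lazyCos_pow (r a u : ℝ) :
    Tendsto (fun k : ℕ => lazyCos r a (u / Real.sqrt k) ^ k) atTop
      (nhds (Real.exp (-(r * a ^ 2 / 2) * u ^ 2))) := by
  refine Real.tendsto_one_add_pow_exp_of_tendsto
    (g := fun k : ℕ => r * (Real.cos (a * (u / Real.sqrt k)) - 1)) ?_
  have hsq : ∀ᶠ k : ℕ in atTop, (k : ℝ) * (r * (Real.cos (a * (u / Real.sqrt k)) - 1)) =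
      -(r / 2) * (a * u * Real.sinc (a * u / 2 * (1 / Real.sqrt k))) ^ 2 := by
    filter_upwards [eventually_gt_atTop 0] with k hk
    have hk' : (0 : ℝ) < k := by exact_mod_cast hk
    have h1 : Real.sqrt k ^ 2 = k := Real.sq_sqrt hk'.le
    have h2 : Real.sqrt k ≠ 0 := (Real.sqrt_pos.2 hk').ne'
    have h3 : Real.cos (a * (u / Real.sqrt k)) - 1 =
        -2 * Real.sin (a * u / 2 * (1 / Real.sqrt k)) ^ 2 := by
      have : a * (u / Real.sqrt k) = 2 * (a * u / 2 * (1 / Real.sqrt k)) := by ring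
      rw [this, Real.cos_two_mul, Real.cos_sq']
      ring
    rw [h3]
    rcases eq_or_ne (a * u) 0 with h0 | h0
    · simp [h0]
    · rw [Real.sinc_of_ne_zero (by positivity)]
      have h4 : a * u * (Real.sin (a * u / 2 * (1 / Real.sqrt k)) /
          (a * u / 2 * (1 / Real.sqrt k))) =
          2 * Real.sqrt k * Real.sin (a * u / 2 * (1 / Real.sqrt k)) := by
        rw [mul_div_assoc', mul_comm (a * u), div_eq_iff (by positivity)]
        field_simp
      rw [h4, mul_pow, mul_pow, h1]
      ring
  refine Tendsto.congr' (EventuallyEq.symm hsq) ?_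
  have hz : Tendsto (fun k : ℕ => 1 / Real.sqrt k) atTop (nhds 0) :=
    (tendsto_const_nhds (x := (1 : ℝ))).div_atTop
      (Real.tendsto_sqrt_atTop.comp tendsto_natCast_atTop_atTop)
  have := ((Real.continuous_sinc.tendsto _).comp (hz.const_mul (a * u / 2)))
  have := ((this.const_mul (a * u)).pow 2).const_mul (-(r / 2))
  rw [mul_zero, Real.sinc_zero] at this
  have hr : -(r * a ^ 2 / 2) * u ^ 2 = -(r / 2) * (a * u * 1) ^ 2 := by ring
  rw [hr]
  exact this

lemma integral_exp_neg_mul_sq_mul_cos {b : ℝ} (hb : 0 < b) (z : ℝ) :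
    ∫ u : ℝ, Real.exp (-b * u ^ 2) * Real.cos (z * u) =
      Real.sqrt (Real.pi / b) * Real.exp (-z ^ 2 / (4 * b)) := by
  have h := fourierIntegral_gaussian (b := (b : ℂ)) (by simpa using hb) (z : ℂ)
  have hr : ((Real.pi : ℂ) / b) ^ (1 / 2 : ℂ) = ((Real.sqrt (Real.pi / b) : ℝ) : ℂ) := by
    rw [Real.sqrt_eq_rpow, Complex.ofReal_cpow (by positivity)]
    push_cast; rfl
  have hfi : Integrable (fun x : ℝ =>
      Complex.exp (Complex.I * z * x) * Complex.exp (-b * x ^ 2)) := by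
    have := integrable_cexp_quadratic (b := (b : ℂ)) (by simpa using hb) (Complex.I * z) 0
    refine this.congr (Eventually.of_forall fun x => ?_)
    simp only [← Complex.exp_add]
    congr 1; ring
  have h2 := congrArg Complex.re h
  have h3 : (∫ x : ℝ, Complex.exp (Complex.I * z * x) * Complex.exp (-b * x ^ 2)).re =
      ∫ x : ℝ, (Complex.exp (Complex.I * z * x) * Complex.exp (-b * x ^ 2)).re :=
    (integral_re hfi).symm
  have h4 : ∀ x : ℝ, (Complex.exp (Complex.I * z * x) * Complex.exp (-b * x ^ 2)).re =
      Real.exp (-b * x ^ 2) * Real.cos (z * x) := by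
    intro x
    have e1 : Complex.exp (-(b : ℂ) * x ^ 2) = ((Real.exp (-b * x ^ 2) : ℝ) : ℂ) := by
      push_cast; rfl
    have e2 : Complex.I * z * x = ((z * x : ℝ) : ℂ) * Complex.I := by push_cast; ring
    rw [e1, e2, Complex.re_mul_ofReal, Complex.exp_ofReal_mul_I_re, mul_comm]
  rw [h3, hr] at h2
  simp_rw [h4] at h2
  rw [h2, Complex.re_ofReal_mul]
  have e3 : Complex.exp (-(z : ℂ) ^ 2 / (4 * b)) = ((Real.exp (-z ^ 2 / (4 * b)) : ℝ) : ℂ) := by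
    push_cast; rfl
  rw [e3, Complex.ofReal_re]

lemma mul_integral_eq_integral_indicator (φ : ℝ → ℝ) {s A : ℝ} (hs : 0 < s) (hA : 0 ≤ A) :
    s * ∫ θ in (-A)..A, φ θ =
      ∫ u, (Set.Ioc (-A * s) (A * s)).indicator (fun u => φ (u / s)) u := by
  rw [integral_indicator measurableSet_Ioc, ← intervalIntegral.integral_of_le (by nlinarith),
    intervalIntegral.integral_comp_div _ hs.ne', mul_div_cancel_right₀ _ hs.ne',
    mul_div_cancel_right₀ _ hs.ne', smul_eq_mul]

lemma norm_indicator_pow_mul_cos_le {g : ℝ → ℝ} {c : ℝ}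
    (hgc : ∀ θ, |θ| ≤ Real.pi → |g θ| ≤ Real.exp (-c * θ ^ 2)) {k : ℕ} (hk : 0 < k) (w u : ℝ) :
    ‖(Set.Ioc (-Real.pi * Real.sqrt k) (Real.pi * Real.sqrt k)).indicator
      (fun u => g (u / Real.sqrt k) ^ k * Real.cos (w * (u / Real.sqrt k))) u‖ ≤
      Real.exp (-c * u ^ 2) := by
  have hk' : (0 : ℝ) < k := by exact_mod_cast hk
  have hs : 0 < Real.sqrt k := Real.sqrt_pos.2 hk'
  rw [Set.indicator_apply]
  split_ifs with hu
  · have h1 : |u / Real.sqrt k| ≤ Real.pi := by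
      rw [abs_div, abs_of_pos hs, div_le_iff₀ hs, abs_le]
      exact ⟨by linarith [hu.1], hu.2⟩
    rw [norm_mul, norm_pow, Real.norm_eq_abs, Real.norm_eq_abs]
    calc _ ≤ Real.exp (-c * (u / Real.sqrt k) ^ 2) ^ k * 1 := by
          gcongr
          · exact hgc _ h1
          · exact Real.abs_cos_le_one _
      _ = Real.exp (-c * u ^ 2) := by
          rw [mul_one, ← Real.exp_nat_mul, div_pow, Real.sq_sqrt hk'.le]
          congr 1
          field_simp
  · rw [norm_zero]; positivity

/-- A Gaussian bound on `[-π, π]` bounds the rescaled Fourier integrals of powers. -/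
lemma abs_sqrt_mul_integral_pow_le {g : ℝ → ℝ} {c : ℝ} (hc : 0 < c)
    (hgc : ∀ θ, |θ| ≤ Real.pi → |g θ| ≤ Real.exp (-c * θ ^ 2)) (k : ℕ) (w : ℝ) :
    |Real.sqrt k * ∫ θ in (-Real.pi)..Real.pi, g θ ^ k * Real.cos (w * θ)| ≤
      Real.sqrt (Real.pi / c) := by
  rcases Nat.eq_zero_or_pos k with rfl | hk
  · simp
  have hs : 0 < Real.sqrt k := Real.sqrt_pos.2 (by exact_mod_cast hk)
  rw [mul_integral_eq_integral_indicator _ hs Real.pi_pos.le, ← integral_gaussian,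
    ← Real.norm_eq_abs]
  exact norm_integral_le_of_norm_le (integrable_exp_neg_mul_sq hc)
    (Eventually.of_forall fun u => norm_indicator_pow_mul_cos_le hgc hk w u)

lemma tendsto_sqrt_mul_integral_pow {g : ℝ → ℝ} (hg : Continuous g) {c b : ℝ} (hc : 0 < c)
    (hb : 0 < b) (hgc : ∀ θ, |θ| ≤ Real.pi → |g θ| ≤ Real.exp (-c * θ ^ 2))
    (hgb : ∀ u, Tendsto (fun k : ℕ => g (u / Real.sqrt k) ^ k) atTop
      (nhds (Real.exp (-b * u ^ 2))))
    {k : ℕ → ℕ} (hk : Tendsto k atTop atTop) {w : ℕ → ℝ} {z : ℝ}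
    (hw : Tendsto (fun n => w n / Real.sqrt (k n)) atTop (nhds z)) :
    Tendsto (fun n => Real.sqrt (k n) *
        ∫ θ in (-Real.pi)..Real.pi, g θ ^ k n * Real.cos (w n * θ)) atTop
      (nhds (Real.sqrt (Real.pi / b) * Real.exp (-z ^ 2 / (4 * b)))) := by
  rw [← integral_exp_neg_mul_sq_mul_cos hb]
  have hs : Tendsto (fun n => Real.sqrt (k n)) atTop atTop :=
    Real.tendsto_sqrt_atTop.comp (tendsto_natCast_atTop_atTop.comp hk)
  have heq : (fun n => ∫ u, (Set.Ioc (-Real.pi * Real.sqrt (k n))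
      (Real.pi * Real.sqrt (k n))).indicator
      (fun u => g (u / Real.sqrt (k n)) ^ k n * Real.cos (w n * (u / Real.sqrt (k n)))) u)
      =ᶠ[atTop] fun n => Real.sqrt (k n) *
        ∫ θ in (-Real.pi)..Real.pi, g θ ^ k n * Real.cos (w n * θ) := by
    filter_upwards [hs.eventually_gt_atTop 0] with n hn
    rw [mul_integral_eq_integral_indicator _ hn Real.pi_pos.le]
  refine Tendsto.congr' heq ?_
  refine tendsto_integral_filter_of_dominated_convergence (fun u => Real.exp (-c * u ^ 2)) ?_ ?_
    (integrable_exp_neg_mul_sq hc) (Eventually.of_forall fun u => ?_)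
  · refine Eventually.of_forall fun n => ?_
    exact (Continuous.aestronglyMeasurable (by fun_prop)).indicator measurableSet_Ioc
  · filter_upwards [hk.eventually_gt_atTop 0] with n hn
    exact Eventually.of_forall fun u => norm_indicator_pow_mul_cos_le hgc hn (w n) u
  · have h1 : Tendsto (fun n => g (u / Real.sqrt (k n)) ^ k n) atTop
        (nhds (Real.exp (-b * u ^ 2))) := (hgb u).comp hk
    have h2 : Tendsto (fun n => Real.cos (w n / Real.sqrt (k n) * u)) atTop
        (nhds (Real.cos (z * u))) :=
      (Real.continuous_cos.tendsto _).comp (hw.mul_const u)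
    refine (h1.mul h2).congr' ?_
    filter_upwards [hs.eventually_gt_atTop (|u| / Real.pi)] with n hn
    rw [div_lt_iff₀ Real.pi_pos, abs_lt] at hn
    rw [Set.indicator_of_mem (Set.mem_Ioc.2 ⟨by linarith [hn.1], by linarith [hn.2]⟩)]
    congr 2
    ring

lemma integral_exp_int_mul (m : ℤ) :
    ∫ θ in (-Real.pi)..Real.pi, Complex.exp (m * Complex.I * θ) =
      if m = 0 then (2 * Real.pi : ℂ) else 0 := by
  split_ifs with h
  · simp [h]; ring
  · have hm : (m : ℂ) * Complex.I ≠ 0 := mul_ne_zero (by exact_mod_cast h) Complex.I_ne_zero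
    rw [integral_exp_mul_complex hm]
    have : Complex.exp (m * Complex.I * (Real.pi : ℝ)) =
        Complex.exp (m * Complex.I * ((-Real.pi : ℝ) : ℂ)) := by
      rw [Complex.exp_eq_exp_iff_exists_int]
      exact ⟨m, by push_cast; ring⟩
    rw [this, sub_self, zero_div]

lemma two_pi_mul_trinom (k : ℕ) :
    2 * Real.pi * (trinom k : ℝ) =
      3 ^ k * ∫ θ in (-Real.pi)..Real.pi, lazyCos (2 / 3) 1 θ ^ k * Real.cos (0 * θ) := by
  have h1 : ∀ θ : ℝ, (((3 : ℝ) ^ k * (lazyCos (2 / 3) 1 θ ^ k * Real.cos (0 * θ)) : ℝ) : ℂ) =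
      ∑ p : Fin k → Fin 3, Complex.exp (((∑ i, ((p i : ℤ) - 1) : ℤ) : ℂ) * Complex.I * θ) := by
    intro θ
    have h2 : ∀ p : Fin k → Fin 3,
        Complex.exp (((∑ i, ((p i : ℤ) - 1) : ℤ) : ℂ) * Complex.I * θ) =
        ∏ i, Complex.exp ((((p i : ℤ) - 1 : ℤ) : ℂ) * Complex.I * θ) := by
      intro p
      rw [← Complex.exp_sum, Int.cast_sum, Finset.sum_mul, Finset.sum_mul]
    simp_rw [h2]
    rw [← Fintype.sum_pow (fun a : Fin 3 =>
      Complex.exp ((((a : ℕ) : ℤ) - 1 : ℤ) * Complex.I * θ)) k, Fin.sum_univ_three]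
    unfold lazyCos
    simp only [zero_mul, Real.cos_zero, mul_one, one_mul, ← mul_pow]
    push_cast
    congr 1
    simp only [Fin.val_zero, Fin.val_one, Fin.val_two, Complex.cos]
    push_cast
    have e0 : ((0 : ℂ) - 1) * Complex.I * θ = -θ * Complex.I := by ring
    have e1 : ((1 : ℂ) - 1) * Complex.I * θ = 0 := by ring
    have e2 : ((2 : ℂ) - 1) * Complex.I * θ = θ * Complex.I := by ring
    rw [e0, e1, e2, Complex.exp_zero]
    ring
  have h4 : ((2 * Real.pi * (trinom k : ℝ) : ℝ) : ℂ) = ((3 ^ k *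
      ∫ θ in (-Real.pi)..Real.pi, lazyCos (2 / 3) 1 θ ^ k * Real.cos (0 * θ) : ℝ) : ℂ) := by
    rw [← intervalIntegral.integral_const_mul, ← intervalIntegral.integral_ofReal]
    simp_rw [h1]
    rw [intervalIntegral.integral_finsetSum
      (fun p _ => Continuous.intervalIntegrable (by fun_prop) _ _)]
    simp_rw [integral_exp_int_mul]
    rw [← Finset.sum_filter, Finset.sum_const, trinom, nsmul_eq_mul]
    push_cast
    ring
  exact_mod_cast h4

lemma two_pi_mul_choose {m i : ℕ} (hi : i ≤ m) :
    2 * Real.pi * (m.choose i : ℝ) = 2 ^ m *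
      ∫ θ in (-Real.pi)..Real.pi, lazyCos 1 (1 / 2) θ ^ m * Real.cos (((m : ℝ) / 2 - i) * θ) := by
  have h1 : ∀ θ : ℝ, (2 : ℝ) ^ m * (lazyCos 1 (1 / 2) θ ^ m *
      Real.cos (((m : ℝ) / 2 - i) * θ)) = (∑ j ∈ Finset.range (m + 1),
        (m.choose j : ℂ) * Complex.exp (((j - i : ℤ) : ℂ) * Complex.I * θ)).re := by
    intro θ
    have h2 : ∑ j ∈ Finset.range (m + 1),
        (m.choose j : ℂ) * Complex.exp (((j - i : ℤ) : ℂ) * Complex.I * θ) =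
        (Complex.exp (Complex.I * θ) + 1) ^ m * Complex.exp (-i * Complex.I * θ) := by
      rw [add_pow, Finset.sum_mul]
      refine Finset.sum_congr rfl fun j _ => ?_
      rw [one_pow, mul_one, ← Complex.exp_nat_mul, mul_comm _ (m.choose j : ℂ),
        mul_assoc (m.choose j : ℂ),
        ← Complex.exp_add]
      congr 2
      push_cast
      ring
    have h3 : Complex.exp (Complex.I * θ) + 1 =
        ((2 * lazyCos 1 (1 / 2) θ : ℝ) : ℂ) * Complex.exp ((θ / 2 : ℝ) * Complex.I) := by
      have e0 : Complex.exp (Complex.I * θ) = Complex.exp ((θ / 2 : ℝ) * Complex.I) *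
          Complex.exp ((θ / 2 : ℝ) * Complex.I) := by
        rw [← Complex.exp_add]; congr 1; push_cast; ring
      have e1 : (1 : ℂ) = Complex.exp (-(θ / 2 : ℝ) * Complex.I) *
          Complex.exp ((θ / 2 : ℝ) * Complex.I) := by
        rw [← Complex.exp_add, ← add_mul, neg_add_cancel, zero_mul, Complex.exp_zero]
      have e2 : ((2 * lazyCos 1 (1 / 2) θ : ℝ) : ℂ) = Complex.exp ((θ / 2 : ℝ) * Complex.I) +
          Complex.exp (-(θ / 2 : ℝ) * Complex.I) := by
        have e3 : (1 : ℝ) / 2 * θ = θ / 2 := by ring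
        rw [lazyCos, e3, one_mul, add_sub_cancel, Complex.ofReal_mul, Complex.ofReal_cos,
          Complex.cos]
        push_cast
        ring
      rw [e2, add_mul, ← e0, ← e1]
    have h5 : Complex.exp ((θ / 2 : ℝ) * Complex.I) ^ m * Complex.exp (-i * Complex.I * θ) =
        Complex.exp (((((m : ℝ) / 2 - i) * θ : ℝ) : ℂ) * Complex.I) := by
      rw [← Complex.exp_nat_mul, ← Complex.exp_add]
      congr 1
      push_cast
      ring
    rw [h2, h3, mul_pow, mul_assoc, h5, ← Complex.ofReal_pow, Complex.re_ofReal_mul,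
      Complex.exp_ofReal_mul_I_re, mul_pow, mul_assoc]
  have hcont : Continuous fun θ : ℝ => ∑ j ∈ Finset.range (m + 1),
      (m.choose j : ℂ) * Complex.exp (((j - i : ℤ) : ℂ) * Complex.I * θ) := by fun_prop
  have hre : ∫ θ in (-Real.pi)..Real.pi, (∑ j ∈ Finset.range (m + 1),
      (m.choose j : ℂ) * Complex.exp (((j - i : ℤ) : ℂ) * Complex.I * θ)).re =
      (∫ θ in (-Real.pi)..Real.pi, ∑ j ∈ Finset.range (m + 1),
      (m.choose j : ℂ) * Complex.exp (((j - i : ℤ) : ℂ) * Complex.I * θ)).re :=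
    Complex.reCLM.intervalIntegral_comp_comm (hcont.intervalIntegrable _ _)
  rw [← intervalIntegral.integral_const_mul]
  simp_rw [h1]
  rw [hre, intervalIntegral.integral_finsetSum
      (fun j _ => Continuous.intervalIntegrable (by fun_prop) _ _)]
  simp_rw [intervalIntegral.integral_const_mul, integral_exp_int_mul]
  rw [Finset.sum_eq_single i (fun j _ hj => by rw [if_neg (by omega), mul_zero])
    (fun h => absurd (Finset.mem_range.2 (by omega)) h), if_pos (sub_self _)]
  have : (m.choose i : ℂ) * (2 * Real.pi) = ((m.choose i * (2 * Real.pi) : ℝ) : ℂ) := by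
    push_cast; ring
  rw [this, Complex.ofReal_re]
  ring

lemma abs_lazyCos_trinom_le (θ : ℝ) (hθ : |θ| ≤ Real.pi) :
    |lazyCos (2 / 3) 1 θ| ≤ Real.exp (-(1 / Real.pi ^ 2) * θ ^ 2) := by
  have h1 := Real.cos_le_one_sub_mul_cos_sq hθ
  have h2 : θ ^ 2 ≤ Real.pi ^ 2 := sq_le_sq' (by linarith [(abs_le.1 hθ).1]) (abs_le.1 hθ).2
  have hpi := Real.pi_pos
  set q : ℝ := 1 / Real.pi ^ 2 * θ ^ 2 with hq
  have hq1 : q ≤ 1 := by rw [hq, one_div_mul_eq_div]; exact (div_le_one (by positivity)).2 h2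
  have hq0 : 0 ≤ q := by positivity
  have h4 : 2 / Real.pi ^ 2 * θ ^ 2 = 2 * q := by rw [hq]; ring
  have h3 : Real.exp (-1) ≤ Real.exp (-q) := Real.exp_le_exp.2 (by linarith)
  have h5 : (1 : ℝ) / 3 ≤ Real.exp (-1) := by
    rw [Real.exp_neg, ← one_div]
    exact one_div_le_one_div_of_le (Real.exp_pos 1) (by linarith [Real.exp_one_lt_d9])
  have h6 := Real.add_one_le_exp (-q)
  rw [neg_mul, ← hq, abs_le, lazyCos, one_mul]
  have h7 := Real.neg_one_le_cos θ
  constructor <;> linarith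

lemma abs_lazyCos_choose_le (θ : ℝ) (hθ : |θ| ≤ Real.pi) :
    |lazyCos 1 (1 / 2) θ| ≤ Real.exp (-(1 / (2 * Real.pi ^ 2)) * θ ^ 2) := by
  have hpi := Real.pi_pos
  have h1 := Real.cos_le_one_sub_mul_cos_sq (x := 1 / 2 * θ) (by
    rw [abs_mul, abs_of_pos (by norm_num : (0 : ℝ) < 1 / 2)]; linarith [abs_nonneg θ])
  have h2 : 0 ≤ Real.cos (1 / 2 * θ) := Real.cos_nonneg_of_neg_pi_div_two_le_of_le
    (by linarith [(abs_le.1 hθ).1]) (by linarith [(abs_le.1 hθ).2])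
  have h6 := Real.add_one_le_exp (-(1 / (2 * Real.pi ^ 2)) * θ ^ 2)
  have h7 : 2 / Real.pi ^ 2 * (1 / 2 * θ) ^ 2 = 1 / (2 * Real.pi ^ 2) * θ ^ 2 := by
    field_simp
  rw [lazyCos, abs_of_nonneg (by linarith)]
  linarith

/-- The central trinomial coefficient divided by its order of growth `3 ^ h / √h`. -/
noncomputable def trinomRatio (h : ℕ) : ℝ := Real.sqrt h * trinom h / 3 ^ h

/-- The binomial coefficient divided by `2 ^ m / √m`. -/
noncomputable def chooseRatio (m i : ℕ) : ℝ := Real.sqrt m * m.choose i / 2 ^ m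

lemma trinomRatio_eq (h : ℕ) : trinomRatio h = (2 * Real.pi)⁻¹ * (Real.sqrt h *
    ∫ θ in (-Real.pi)..Real.pi, lazyCos (2 / 3) 1 θ ^ h * Real.cos (0 * θ)) := by
  have := two_pi_mul_trinom h
  have hpi := Real.pi_pos
  rw [trinomRatio, div_eq_iff (by positivity), mul_assoc, mul_assoc, eq_inv_mul_iff_mul_eq₀
    (by positivity)]
  linear_combination Real.sqrt h * this

lemma chooseRatio_eq {m i : ℕ} (hi : i ≤ m) : chooseRatio m i = (2 * Real.pi)⁻¹ * (Real.sqrt m *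
    ∫ θ in (-Real.pi)..Real.pi, lazyCos 1 (1 / 2) θ ^ m * Real.cos (((m : ℝ) / 2 - i) * θ)) := by
  have := two_pi_mul_choose hi
  have hpi := Real.pi_pos
  rw [chooseRatio, div_eq_iff (by positivity), mul_assoc, mul_assoc, eq_inv_mul_iff_mul_eq₀
    (by positivity)]
  linear_combination Real.sqrt m * this

lemma exists_trinomRatio_le : ∃ C, 0 < C ∧ ∀ h, trinomRatio h ≤ C := by
  refine ⟨(2 * Real.pi)⁻¹ * Real.sqrt (Real.pi / (1 / Real.pi ^ 2)), by positivity, fun h => ?_⟩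
  rw [trinomRatio_eq]
  gcongr
  exact (le_abs_self _).trans
    (abs_sqrt_mul_integral_pow_le (by positivity) abs_lazyCos_trinom_le h 0)

lemma exists_chooseRatio_le : ∃ C, 0 < C ∧ ∀ m i, i ≤ m → chooseRatio m i ≤ C := by
  refine ⟨(2 * Real.pi)⁻¹ * Real.sqrt (Real.pi / (1 / (2 * Real.pi ^ 2))), by positivity,
    fun m i hi => ?_⟩
  rw [chooseRatio_eq hi]
  gcongr
  exact (le_abs_self _).trans
    (abs_sqrt_mul_integral_pow_le (by positivity) abs_lazyCos_choose_le m _)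

lemma exists_tendsto_trinomRatio : ∃ L, 0 < L ∧ Tendsto trinomRatio atTop (nhds L) := by
  have h := (tendsto_sqrt_mul_integral_pow (continuous_lazyCos (2 / 3) 1)
    (c := 1 / Real.pi ^ 2) (b := 2 / 3 * 1 ^ 2 / 2)
    (by positivity) (by positivity) abs_lazyCos_trinom_le (tendsto_lazyCos_pow _ _)
    tendsto_id (w := fun _ => 0) (z := 0) (by simp)).const_mul (2 * Real.pi)⁻¹
  exact ⟨_, by positivity, h.congr fun n => (trinomRatio_eq n).symm⟩

/-- Local central limit theorem for binomial coefficients. -/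
lemma exists_tendsto_chooseRatio : ∃ K, 0 < K ∧ ∀ (h i : ℕ → ℕ) (z : ℝ),
    Tendsto (fun n => h n + 2 * i n) atTop atTop →
    Tendsto (fun n => (h n : ℝ) / Real.sqrt ((h n + 2 * i n : ℕ) : ℝ)) atTop (nhds z) →
    Tendsto (fun n => chooseRatio (h n + 2 * i n) (i n)) atTop
      (nhds (K * Real.exp (-z ^ 2 / 2))) := by
  refine ⟨(2 * Real.pi)⁻¹ * Real.sqrt (Real.pi / (1 * (1 / 2) ^ 2 / 2)), by positivity,
    fun h i z hm hz => ?_⟩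
  have := (tendsto_sqrt_mul_integral_pow (continuous_lazyCos 1 (1 / 2))
    (c := 1 / (2 * Real.pi ^ 2)) (b := 1 * (1 / 2) ^ 2 / 2)
    (by positivity) (by positivity) abs_lazyCos_choose_le (tendsto_lazyCos_pow _ _)
    hm (w := fun n => ((h n + 2 * i n : ℕ) : ℝ) / 2 - i n) (z := z / 2)
    ((hz.div_const 2).congr fun n => by push_cast; ring)).const_mul (2 * Real.pi)⁻¹
  have hz2 : -(z / 2) ^ 2 / (4 * (1 * (1 / 2) ^ 2 / 2)) = -z ^ 2 / 2 := by ring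
  rw [hz2, ← mul_assoc] at this
  exact this.congr fun n => (chooseRatio_eq (by omega)).symm

lemma choose_mul_two_mul_add_sq_le {m i : ℕ} (h : 2 * (i + 1) ≤ m) :
    (m.choose i : ℝ) * (2 * m + ((m : ℝ) - 2 * i) ^ 2) ≤
      m.choose (i + 1) * (2 * m + ((m : ℝ) - 2 * (i + 1 : ℕ)) ^ 2) := by
  have h1 : (m.choose (i + 1) : ℝ) * (i + 1) = m.choose i * ((m : ℝ) - i) := by
    have := Nat.choose_succ_right_eq m i
    rw [← Nat.cast_sub (by omega)]
    exact_mod_cast this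
  have h2 : (m.choose (i + 1) : ℝ) = m.choose i * ((m : ℝ) - i) / (i + 1) := by
    rw [eq_div_iff (by positivity), h1]
  have hm : 2 * ((i : ℝ) + 1) ≤ m := by exact_mod_cast h
  rw [h2, div_mul_eq_mul_div, le_div_iff₀ (by positivity), mul_assoc, mul_assoc]
  refine mul_le_mul_of_nonneg_left ?_ (Nat.cast_nonneg _)
  push_cast
  have h3 : 0 ≤ ((m : ℝ) - 2 * i) * ((m : ℝ) - 2 * i - 1) * ((m : ℝ) - 2 * i - 2) :=
    mul_nonneg (mul_nonneg (by linarith) (by linarith)) (by linarith)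
  nlinarith

lemma choose_mul_two_mul_add_sq_le_middle {m i : ℕ} (h : 2 * i ≤ m) :
    (m.choose i : ℝ) * (2 * m + ((m : ℝ) - 2 * i) ^ 2) ≤ m.choose (m / 2) * (2 * m + 1) := by
  obtain ⟨d, hd⟩ : ∃ d, i + d = m / 2 := ⟨m / 2 - i, by omega⟩
  induction d generalizing i with
  | zero =>
    obtain rfl : i = m / 2 := by omega
    gcongr
    have h1 : (2 : ℝ) * (m / 2 : ℕ) ≤ m := by exact_mod_cast h
    have h2 : (m : ℝ) ≤ 2 * (m / 2 : ℕ) + 1 := by exact_mod_cast (by omega)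
    nlinarith
  | succ d ih =>
    exact (choose_mul_two_mul_add_sq_le (by omega)).trans (ih (by omega) (by omega))

lemma exists_chooseRatio_le_rpow : ∃ C, 0 < C ∧ ∀ h i : ℕ, 0 < h → ∀ p : ℝ, 0 ≤ p → p ≤ 1 →
    chooseRatio (h + 2 * i) i ≤ C * (((h + 2 * i : ℕ) : ℝ) / (h : ℝ) ^ 2) ^ p := by
  obtain ⟨C, hC, hb⟩ := exists_chooseRatio_le
  refine ⟨3 * C, by positivity, fun h i hh p hp0 hp1 => ?_⟩
  have hh' : (0 : ℝ) < h := by exact_mod_cast hh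
  set m := h + 2 * i with hm
  have hm1 : (1 : ℝ) ≤ m := by exact_mod_cast (by omega)
  have h1 : chooseRatio m i ≤ C := hb _ _ (by omega)
  have h2 : chooseRatio m i ≤ 3 * C * ((m : ℝ) / (h : ℝ) ^ 2) := by
    have h3 := choose_mul_two_mul_add_sq_le_middle (m := m) (i := i) (by omega)
    have h4 := hb m (m / 2) (by omega)
    have h5 : ((m : ℝ) - 2 * i) = h := by rw [hm]; push_cast; ring
    rw [h5] at h3
    have h6 : chooseRatio m i * (2 * m + (h : ℝ) ^ 2) ≤
        chooseRatio m (m / 2) * (2 * m + 1) := by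
      have h7 : ∀ j (c : ℝ), chooseRatio m j * c = Real.sqrt m / 2 ^ m * (m.choose j * c) :=
        fun j c => by unfold chooseRatio; ring
      rw [h7, h7]
      gcongr
    have h8 : 0 ≤ chooseRatio m i := by unfold chooseRatio; positivity
    rw [mul_div_assoc', le_div_iff₀ (by positivity)]
    nlinarith
  rcases le_total ((m : ℝ) / (h : ℝ) ^ 2) 1 with ht | ht
  · refine h2.trans ?_
    gcongr
    simpa using Real.rpow_le_rpow_of_exponent_ge (by positivity) ht hp1
  · have := Real.one_le_rpow ht hp0
    nlinarith

/-- The weight of a pair (cycle length, external area), rescaled to have a limit. -/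
noncomputable def scaledCount (n h i : ℕ) : ℝ :=
  Ncount n h i * (2 * n : ℝ) ^ (9 / 4 : ℝ) / 12 ^ n

lemma scaledCount_eq {n h i j : ℕ} (hh : 0 < h) (hn : h + i + j = n) :
    scaledCount n h i = trinomRatio h * ((h : ℝ) / Real.sqrt (2 * n)) ^ (3 / 2 : ℝ) *
      (((h + 2 * i : ℕ) : ℝ) / (2 * n) * (((h + 2 * j : ℕ) : ℝ) / (2 * n))) ^ (-3 / 2 : ℝ) *
      chooseRatio (h + 2 * i) i * chooseRatio (h + 2 * j) j := by
  have hj : n - h - i = j := by omega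
  have hnh : n - h = i + j := by omega
  have hn0 : (0 : ℝ) < 2 * n := by
    have : (0 : ℝ) < n := by exact_mod_cast (by omega)
    positivity
  have hh' : (0 : ℝ) < h := by exact_mod_cast hh
  set a : ℝ := ((h + 2 * i : ℕ) : ℝ) with ha
  set b : ℝ := ((h + 2 * j : ℕ) : ℝ) with hb
  have ha0 : 0 < a := by rw [ha]; exact_mod_cast (by omega)
  have hb0 : 0 < b := by rw [hb]; exact_mod_cast (by omega)
  have h12 : (12 : ℝ) ^ n = 3 ^ (i + j) * 3 ^ h * 2 ^ (h + 2 * i) * 2 ^ (h + 2 * j) := by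
    rw [show (12 : ℝ) = 3 * 2 ^ 2 by norm_num, mul_pow, ← pow_mul, ← pow_add, mul_assoc, ← pow_add]
    congr 2 <;> omega
  have e1 : ((h : ℝ) / Real.sqrt (2 * n)) ^ (3 / 2 : ℝ) =
      h * Real.sqrt h / (2 * n : ℝ) ^ (3 / 4 : ℝ) := by
    rw [Real.div_rpow hh'.le (Real.sqrt_nonneg _), Real.sqrt_eq_rpow, Real.sqrt_eq_rpow,
      ← Real.rpow_mul hn0.le, ← Real.rpow_one_add' hh'.le (by norm_num)]
    norm_num
  have e2 : (a / (2 * n) * (b / (2 * n))) ^ (-3 / 2 : ℝ) =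
      (2 * n : ℝ) ^ (3 : ℝ) / (a * Real.sqrt a * (b * Real.sqrt b)) := by
    rw [Real.sqrt_eq_rpow, Real.sqrt_eq_rpow, ← Real.rpow_one_add' ha0.le (by norm_num),
      ← Real.rpow_one_add' hb0.le (by norm_num), show (-3 / 2 : ℝ) = -(3 / 2) by norm_num,
      Real.rpow_neg (by positivity), Real.mul_rpow (by positivity) (by positivity),
      Real.div_rpow ha0.le hn0.le, Real.div_rpow hb0.le hn0.le]
    rw [show (2 * n : ℝ) ^ (3 : ℝ) = (2 * n : ℝ) ^ (3 / 2 : ℝ) * (2 * n : ℝ) ^ (3 / 2 : ℝ) by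
      rw [← Real.rpow_add hn0]; norm_num]
    have h32 : (1 : ℝ) + 1 / 2 = 3 / 2 := by norm_num
    rw [h32]
    field_simp
  have e3 : (2 * n : ℝ) ^ (3 : ℝ) = (2 * n : ℝ) ^ (9 / 4 : ℝ) * (2 * n : ℝ) ^ (3 / 4 : ℝ) := by
    rw [← Real.rpow_add hn0]; norm_num
  rw [scaledCount, Ncount, hj, hnh, h12, e1, e2, e3, trinomRatio, chooseRatio, chooseRatio,
    Fforest, Fforest, ← ha, ← hb]
  have ha' : (h : ℝ) + 2 * i = a := by rw [ha]; push_cast; ring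
  have hb' : (h : ℝ) + 2 * j = b := by rw [hb]; push_cast; ring
  rw [ha', hb']
  have hsh := Real.mul_self_sqrt hh'.le
  have p1 := Real.rpow_pos_of_pos hn0 (3 / 4)
  have p2 := Real.sqrt_pos.2 ha0
  have p3 := Real.sqrt_pos.2 hb0
  have p4 := Real.sqrt_pos.2 hh'
  generalize (2 * n : ℝ) ^ (9 / 4 : ℝ) = R at *
  generalize (2 * n : ℝ) ^ (3 / 4 : ℝ) = S at *
  generalize Real.sqrt a = A at *
  generalize Real.sqrt b = B at *
  field_simp
  rw [sq, hsh]
  ring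

/-- The dominating function in the cycle length. -/
noncomputable def lengthBound (x : ℝ) : ℝ :=
  if x ≤ 1 then x ^ (-9 / 10 : ℝ) else x ^ (-3 / 2 : ℝ)

lemma exists_scaledCount_le : ∃ C, 0 < C ∧ ∀ (n h i : ℕ) (x y : ℝ), 0 < h → h + i ≤ n →
    0 < x → 0 < y → y < 1 → x ≤ h / Real.sqrt (2 * n) → y * n ≤ i + 1 → i ≤ y * n →
    scaledCount n h i ≤ C * (lengthBound x * (y / 2 * ((1 - y) / 2)) ^ (-9 / 10 : ℝ)) := by
  obtain ⟨C₁, hC₁, hb₁⟩ := exists_trinomRatio_le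
  obtain ⟨C₂, hC₂, hb₂⟩ := exists_chooseRatio_le_rpow
  refine ⟨C₁ * C₂ * C₂, by positivity, fun n h i x y hh hn hx hy0 hy1 hxh hyi hiy => ?_⟩
  obtain ⟨j, rfl⟩ : ∃ j, n = h + i + j := ⟨n - h - i, by omega⟩
  rw [scaledCount_eq hh rfl]
  set n := h + i + j with hn_def
  have hn0 : (0 : ℝ) < n := by exact_mod_cast (by omega)
  have hh1 : (1 : ℝ) ≤ h := by exact_mod_cast hh
  have hnr : (n : ℝ) = h + i + j := by rw [hn_def]; push_cast; ring
  set X := (h : ℝ) / Real.sqrt (2 * n) with hX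
  set U := ((h + 2 * i : ℕ) : ℝ) / (2 * n) with hU
  set V := ((h + 2 * j : ℕ) : ℝ) / (2 * n) with hV
  have hX0 : 0 < X := hx.trans_le hxh
  have hi0 : (0 : ℝ) ≤ i := Nat.cast_nonneg _
  have hj0 : (0 : ℝ) ≤ j := Nat.cast_nonneg _
  have hUy : y / 2 ≤ U := by
    rw [hU, le_div_iff₀ (by positivity)]; push_cast; linarith
  have hVy : (1 - y) / 2 ≤ V := by
    rw [hV, le_div_iff₀ (by positivity)]; push_cast
    linarith
  have hUV : U + V = 1 := by
    rw [hU, hV, ← add_div, div_eq_one_iff_eq (by positivity)]; push_cast; linarith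
  have hU0 : 0 < U := by linarith
  have hV0 : 0 < V := by linarith
  have hX2 : X ^ 2 = (h : ℝ) ^ 2 / (2 * n) := by
    rw [hX, div_pow, Real.sq_sqrt (by positivity)]
  have hUX : ((h + 2 * i : ℕ) : ℝ) / (h : ℝ) ^ 2 = U / X ^ 2 := by
    rw [hX2, hU]; field_simp
  have hVX : ((h + 2 * j : ℕ) : ℝ) / (h : ℝ) ^ 2 = V / X ^ 2 := by
    rw [hX2, hV]; field_simp
  have main : ∀ p : ℝ, 3 / 5 ≤ p → p ≤ 3 / 4 →
      trinomRatio h * X ^ (3 / 2 : ℝ) * (U * V) ^ (-3 / 2 : ℝ) *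
      chooseRatio (h + 2 * i) i * chooseRatio (h + 2 * j) j ≤
      C₁ * C₂ * C₂ * (x ^ (3 / 2 - 4 * p) * (y / 2 * ((1 - y) / 2)) ^ (-9 / 10 : ℝ)) := by
    intro p hp1 hp2
    have b1 := hb₂ h i hh p (by linarith) (by linarith)
    have b2 := hb₂ h j hh p (by linarith) (by linarith)
    rw [hUX] at b1
    rw [hVX] at b2
    have c1 : 0 ≤ chooseRatio (h + 2 * i) i := by unfold chooseRatio; positivity
    have c2 : 0 ≤ chooseRatio (h + 2 * j) j := by unfold chooseRatio; positivity
    have c3 : 0 ≤ trinomRatio h := by unfold trinomRatio; positivity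
    calc _ ≤ C₁ * X ^ (3 / 2 : ℝ) * (U * V) ^ (-3 / 2 : ℝ) * (C₂ * (U / X ^ 2) ^ p) *
          (C₂ * (V / X ^ 2) ^ p) := by
          gcongr
          exact hb₁ h
      _ = C₁ * C₂ * C₂ * (X ^ (3 / 2 - 4 * p) * (U * V) ^ (p - 3 / 2)) := by
          have d1 : (X ^ 2) ^ p = X ^ (2 * p) := by
            rw [← Real.rpow_natCast, ← Real.rpow_mul hX0.le]; norm_num
          have d2 : X ^ (3 / 2 - 4 * p) = X ^ (3 / 2 : ℝ) / (X ^ (2 * p) * X ^ (2 * p)) := by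
            rw [← Real.rpow_add hX0, ← Real.rpow_sub hX0]; congr 1; ring
          have d3 : (U * V) ^ (p - 3 / 2) = (U * V) ^ (-3 / 2 : ℝ) * (U ^ p * V ^ p) := by
            rw [← Real.mul_rpow hU0.le hV0.le, ← Real.rpow_add (by positivity)]
            congr 1; ring
          rw [Real.div_rpow hU0.le (by positivity), Real.div_rpow hV0.le (by positivity), d1, d2,
            d3]
          field_simp
      _ ≤ _ := by
          have hUV1 : U * V ≤ 1 := by nlinarith
          have hy2 : 0 < 1 - y := by linarith
          gcongr ?_ * (?_ * ?_)
          · exact Real.rpow_le_rpow_of_nonpos hx hxh (by linarith)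
          · calc (U * V) ^ (p - 3 / 2) ≤ (U * V) ^ (-9 / 10 : ℝ) :=
                  Real.rpow_le_rpow_of_exponent_ge (by positivity) hUV1 (by linarith)
              _ ≤ _ := Real.rpow_le_rpow_of_nonpos (by positivity) (by gcongr) (by norm_num)
  unfold lengthBound
  split_ifs
  · convert main (3 / 5) (by norm_num) (by norm_num) using 4; norm_num
  · convert main (3 / 4) (by norm_num) (by norm_num) using 4; norm_num

/-- The support `(0, ∞) × (0, 1)` of the limiting law. -/
def strip : Set (ℝ × ℝ) := Set.Ioi (0 : ℝ) ×ˢ Set.Ioo (0 : ℝ) 1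

lemma measurableSet_strip : MeasurableSet strip := measurableSet_Ioi.prod measurableSet_Ioo

lemma volume_restrict_strip : (volume : Measure (ℝ × ℝ)).restrict strip =
    (volume.restrict (Set.Ioi (0 : ℝ))).prod (volume.restrict (Set.Ioo (0 : ℝ) 1)) := by
  rw [strip, Measure.volume_eq_prod, Measure.prod_restrict]

lemma integrableOn_lengthBound : IntegrableOn lengthBound (Set.Ioi 0) := by
  rw [← Set.Ioc_union_Ioi_eq_Ioi zero_le_one]
  refine IntegrableOn.union ?_ ?_
  · have h := (intervalIntegral.intervalIntegrable_rpow' (a := 0) (b := 1)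
      (r := -9 / 10) (by norm_num)).1
    exact h.congr_fun (fun x hx => by simp [lengthBound, hx.2]) measurableSet_Ioc
  · have h := integrableOn_Ioi_rpow_of_lt (a := -3 / 2) (by norm_num) zero_lt_one
    exact h.congr_fun (fun x hx => by simp [lengthBound, not_le.2 (Set.mem_Ioi.1 hx)])
      measurableSet_Ioi

lemma integrableOn_and_integral_mul_one_sub_rpow {a : ℝ} (ha : 0 < a) :
    IntegrableOn (fun y : ℝ => (y * (1 - y)) ^ (a - 1)) (Set.Ioo 0 1) ∧
      ∫ y in Set.Ioo (0 : ℝ) 1, (y * (1 - y)) ^ (a - 1) =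
        Real.Gamma a * Real.Gamma a / Real.Gamma (a + a) := by
  have hc := Complex.betaIntegral_convergent (u := (a : ℂ)) (v := (a : ℂ)) (by simpa) (by simpa)
  have he : ∀ y ∈ Set.Ioo (0 : ℝ) 1, (y : ℂ) ^ ((a : ℂ) - 1) * (1 - (y : ℂ)) ^ ((a : ℂ) - 1) =
      (((y * (1 - y)) ^ (a - 1) : ℝ) : ℂ) := by
    intro y hy
    have h1 : 0 ≤ 1 - y := by linarith [hy.2]
    rw [Real.mul_rpow hy.1.le h1, Complex.ofReal_mul, Complex.ofReal_cpow hy.1.le,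
      Complex.ofReal_cpow h1]
    push_cast
    rfl
  have hb := ProbabilityTheory.beta_eq_betaIntegralReal a a ha ha
  rw [intervalIntegrable_iff_integrableOn_Ioo_of_le zero_le_one] at hc
  have hc' := hc.congr_fun he measurableSet_Ioo
  refine ⟨by simpa [IntegrableOn] using hc'.re, ?_⟩
  rw [Complex.betaIntegral, intervalIntegral.integral_of_le zero_le_one,
    integral_Ioc_eq_integral_Ioo, setIntegral_congr_fun measurableSet_Ioo he,
    integral_complex_ofReal, Complex.ofReal_re] at hb
  rw [← hb, ProbabilityTheory.beta]

lemma integrable_strip_bound : Integrable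
    (fun p : ℝ × ℝ => lengthBound p.1 * (p.2 / 2 * ((1 - p.2) / 2)) ^ (-9 / 10 : ℝ))
    (volume.restrict strip) := by
  rw [volume_restrict_strip]
  refine Integrable.mul_prod (f := lengthBound)
    (g := fun y => (y / 2 * ((1 - y) / 2)) ^ (-9 / 10 : ℝ)) integrableOn_lengthBound ?_
  have h := (integrableOn_and_integral_mul_one_sub_rpow (a := 1 / 10) (by norm_num)).1
  have h' : IntegrableOn (fun y : ℝ => (1 / 4 : ℝ) ^ (-9 / 10 : ℝ) *
      (y * (1 - y)) ^ (1 / 10 - 1 : ℝ)) (Set.Ioo 0 1) := h.const_mul _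
  refine h'.congr_fun (fun y hy => ?_) measurableSet_Ioo
  have h1 : 0 ≤ 1 - y := by linarith [hy.2]
  have h2 : y / 2 * ((1 - y) / 2) = 1 / 4 * (y * (1 - y)) := by ring
  simp only []
  rw [h2, Real.mul_rpow (by norm_num) (mul_nonneg hy.1.le h1)]
  norm_num

/-- The step function on `strip` whose integral is the rescaled sum of the weights. -/
noncomputable def stepFn (n : ℕ) (f : ℝ × ℝ → ℝ) (p : ℝ × ℝ) : ℝ :=
  if ⌈p.1 * Real.sqrt (2 * n)⌉₊ + ⌊p.2 * n⌋₊ ≤ n then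
    scaledCount n ⌈p.1 * Real.sqrt (2 * n)⌉₊ ⌊p.2 * n⌋₊ *
      f (⌈p.1 * Real.sqrt (2 * n)⌉₊ / Real.sqrt (2 * n), ⌊p.2 * n⌋₊ / n)
  else 0

/-- The rectangle on which `stepFn` takes the value attached to `(h, i)`. -/
noncomputable def cell (n h i : ℕ) : Set (ℝ × ℝ) :=
  Set.Ioc (((h : ℝ) - 1) / Real.sqrt (2 * n)) (h / Real.sqrt (2 * n)) ×ˢ
    Set.Ico ((i : ℝ) / n) ((i + 1) / n)

lemma measurableSet_cell (n h i : ℕ) : MeasurableSet (cell n h i) :=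
  measurableSet_Ioc.prod measurableSet_Ico

lemma mem_cell_iff {n h i : ℕ} (hn : 0 < n) (hh : 0 < h) {p : ℝ × ℝ} (hp : p ∈ strip) :
    p ∈ cell n h i ↔ h = ⌈p.1 * Real.sqrt (2 * n)⌉₊ ∧ i = ⌊p.2 * n⌋₊ := by
  have hn' : (0 : ℝ) < n := by exact_mod_cast hn
  have hs : 0 < Real.sqrt (2 * n) := by positivity
  rw [eq_comm, Nat.ceil_eq_iff hh.ne', @eq_comm _ i,
    Nat.floor_eq_iff (mul_nonneg hp.2.1.le hn'.le), cell, Set.mem_prod, Set.mem_Ioc, Set.mem_Ico,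
    div_lt_iff₀ hs, le_div_iff₀ hs, div_le_iff₀ hn', lt_div_iff₀ hn', Nat.cast_sub hh,
    Nat.cast_one]

lemma volume_restrict_strip_cell {n h i : ℕ} (hh : 0 < h) (hi : i < n) :
    (volume.restrict strip) (cell n h i) =
      ENNReal.ofReal (1 / (Real.sqrt (2 * n) * n)) := by
  have hn' : (0 : ℝ) < n := by exact_mod_cast (by omega)
  have hs : 0 < Real.sqrt (2 * n) := by positivity
  have hh' : (1 : ℝ) ≤ h := by exact_mod_cast hh
  have hi' : (i : ℝ) + 1 ≤ n := by exact_mod_cast hi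
  have hsub : Set.Ioc (((h : ℝ) - 1) / Real.sqrt (2 * n)) (h / Real.sqrt (2 * n)) ⊆ Set.Ioi 0 :=
    fun x hx => lt_of_le_of_lt (div_nonneg (by linarith) hs.le) hx.1
  have hsub' : Set.Ico ((i : ℝ) / n) ((i + 1) / n) ⊆ Set.Ico 0 1 :=
    fun x hx => ⟨le_trans (by positivity) hx.1, lt_of_lt_of_le hx.2 ((div_le_one hn').2 hi')⟩
  rw [volume_restrict_strip, cell, Measure.prod_prod, Measure.restrict_congr_set Ioo_ae_eq_Ico,
    Measure.restrict_eq_self _ hsub, Measure.restrict_eq_self _ hsub',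
    Real.volume_Ioc, Real.volume_Ico, ← ENNReal.ofReal_mul]
  · congr 1
    field_simp
    ring
  · rw [← sub_div]
    exact div_nonneg (by linarith) hs.le

lemma stepFn_eq_sum {n : ℕ} (hn : 0 < n) (f : ℝ × ℝ → ℝ) {p : ℝ × ℝ} (hp : p ∈ strip) :
    stepFn n f p = ∑ h ∈ Finset.Icc 1 n, ∑ i ∈ Finset.range (n - h + 1),
      (cell n h i).indicator
        (fun _ => scaledCount n h i * f (h / Real.sqrt (2 * n), i / n)) p := by
  have hn' : (0 : ℝ) < n := by exact_mod_cast hn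
  have hh0 : 0 < ⌈p.1 * Real.sqrt (2 * n)⌉₊ := Nat.ceil_pos.2 (mul_pos hp.1 (by positivity))
  unfold stepFn
  split_ifs with h
  · rw [Finset.sum_eq_single ⌈p.1 * Real.sqrt (2 * n)⌉₊,
      Finset.sum_eq_single ⌊p.2 * n⌋₊,
      Set.indicator_of_mem ((mem_cell_iff hn hh0 hp).2 ⟨rfl, rfl⟩)]
    · intro i _ hi
      exact Set.indicator_of_notMem (fun hc => hi ((mem_cell_iff hn hh0 hp).1 hc).2) _
    · intro hc
      exact absurd (Finset.mem_range.2 (by omega)) hc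
    · intro h' hm hne
      refine Finset.sum_eq_zero fun i _ => ?_
      exact Set.indicator_of_notMem
        (fun hc => hne ((mem_cell_iff hn (Finset.mem_Icc.1 hm).1 hp).1 hc).1) _
    · intro hc
      exact absurd (Finset.mem_Icc.2 (by omega)) hc
  · refine (Finset.sum_eq_zero fun h' hm => Finset.sum_eq_zero fun i hi => ?_).symm
    refine Set.indicator_of_notMem (fun hc => h ?_) _
    obtain ⟨e1, e2⟩ := (mem_cell_iff hn (Finset.mem_Icc.1 hm).1 hp).1 hc
    rw [← e1, ← e2]
    have := Finset.mem_range.1 hi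
    have := Finset.mem_Icc.1 hm
    omega

lemma integral_stepFn {n : ℕ} (hn : 0 < n) (f : ℝ × ℝ → ℝ) :
    ∫ p in strip, stepFn n f p = 1 / (Real.sqrt (2 * n) * n) *
      ∑ h ∈ Finset.Icc 1 n, ∑ i ∈ Finset.range (n - h + 1),
        scaledCount n h i * f (h / Real.sqrt (2 * n), i / n) := by
  have hcell : ∀ h ∈ Finset.Icc 1 n, ∀ i ∈ Finset.range (n - h + 1),
      (volume.restrict strip) (cell n h i) = ENNReal.ofReal (1 / (Real.sqrt (2 * n) * n)) := by
    intro h hh i hi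
    have h1 := Finset.mem_Icc.1 hh
    have h2 := Finset.mem_range.1 hi
    exact volume_restrict_strip_cell (by omega) (by omega)
  have hfi : ∀ h ∈ Finset.Icc 1 n, ∀ i ∈ Finset.range (n - h + 1), Integrable
      ((cell n h i).indicator
        (fun _ => scaledCount n h i * f (h / Real.sqrt (2 * n), i / n)))
      (volume.restrict strip) := by
    intro h hh i hi
    refine (integrable_indicator_iff (measurableSet_cell n h i)).2 (integrableOn_const ?_)
    rw [hcell h hh i hi]
    exact ENNReal.ofReal_ne_top
  rw [setIntegral_congr_fun measurableSet_strip (fun p hp => stepFn_eq_sum hn f hp),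
    integral_finsetSum _ (fun h hh => integrable_finsetSum _ (hfi h hh)), Finset.mul_sum]
  refine Finset.sum_congr rfl fun h hh => ?_
  rw [integral_finsetSum _ (hfi h hh), Finset.mul_sum]
  refine Finset.sum_congr rfl fun i hi => ?_
  rw [integral_indicator_const _ (measurableSet_cell n h i), Measure.real, hcell h hh i hi,
    ENNReal.toReal_ofReal (by positivity), smul_eq_mul]

lemma aestronglyMeasurable_stepFn {n : ℕ} (hn : 0 < n) (f : ℝ × ℝ → ℝ) :
    AEStronglyMeasurable (stepFn n f) (volume.restrict strip) := by
  have h1 : AEStronglyMeasurable (fun p => ∑ h ∈ Finset.Icc 1 n, ∑ i ∈ Finset.range (n - h + 1),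
      (cell n h i).indicator
        (fun _ => scaledCount n h i * f (h / Real.sqrt (2 * n), i / n)) p)
      (volume.restrict strip) :=
    (Finset.measurable_fun_sum _ fun h _ => Finset.measurable_fun_sum _ fun i _ =>
      measurable_const.indicator (measurableSet_cell n h i)).aestronglyMeasurable
  refine h1.congr ?_
  filter_upwards [ae_restrict_mem measurableSet_strip] with p hp
  rw [stepFn_eq_sum hn f hp]

lemma scaledCount_nonneg (n h i : ℕ) : 0 ≤ scaledCount n h i := by
  unfold scaledCount Ncount Fforest
  positivity

lemma exists_abs_stepFn_le : ∃ C, 0 < C ∧ ∀ (n : ℕ), 0 < n → ∀ (f : ℝ × ℝ → ℝ) (M : ℝ),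
    (∀ p, |f p| ≤ M) → ∀ p ∈ strip, |stepFn n f p| ≤
      M * (C * (lengthBound p.1 * (p.2 / 2 * ((1 - p.2) / 2)) ^ (-9 / 10 : ℝ))) := by
  obtain ⟨C, hC, hb⟩ := exists_scaledCount_le
  refine ⟨C, hC, fun n hn f M hM p hp => ?_⟩
  have hn' : (0 : ℝ) < n := by exact_mod_cast hn
  have hs : 0 < Real.sqrt (2 * n) := by positivity
  have hx : 0 < p.1 := hp.1
  have hy : 0 < p.2 := hp.2.1
  have hy1 : 0 < 1 - p.2 := sub_pos.2 hp.2.2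
  have hM0 : 0 ≤ M := (abs_nonneg _).trans (hM p)
  unfold stepFn
  split_ifs with h
  · rw [abs_mul, abs_of_nonneg (scaledCount_nonneg _ _ _), mul_comm]
    refine mul_le_mul (hM _) ?_ (scaledCount_nonneg _ _ _) hM0
    · refine hb _ _ _ _ _ (Nat.ceil_pos.2 (mul_pos hx hs)) h hx hy hp.2.2 ?_
        (Nat.lt_floor_add_one _).le (Nat.floor_le (by positivity))
      rw [le_div_iff₀ hs]
      exact Nat.le_ceil _
  · have : 0 ≤ lengthBound p.1 := by unfold lengthBound; split_ifs <;> positivity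
    rw [abs_zero]
    positivity

lemma tendsto_stepFn {L K : ℝ} (hL : Tendsto trinomRatio atTop (nhds L))
    (hK : ∀ (h i : ℕ → ℕ) (z : ℝ),
      Tendsto (fun n => h n + 2 * i n) atTop atTop →
      Tendsto (fun n => (h n : ℝ) / Real.sqrt ((h n + 2 * i n : ℕ) : ℝ)) atTop (nhds z) →
      Tendsto (fun n => chooseRatio (h n + 2 * i n) (i n)) atTop
        (nhds (K * Real.exp (-z ^ 2 / 2))))
    {f : ℝ × ℝ → ℝ} (hf : Continuous f) {p : ℝ × ℝ} (hp : p ∈ strip) :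
    Tendsto (fun n => stepFn n f p) atTop
      (nhds (L * K ^ 2 * (p.1 ^ (3 / 2 : ℝ) * (p.2 * (1 - p.2)) ^ (-3 / 2 : ℝ) *
        Real.exp (-(p.1 ^ 2) / (2 * (p.2 * (1 - p.2))))) * f p)) := by
  obtain ⟨x, y⟩ := p
  obtain ⟨hx, hy0, hy1⟩ : 0 < x ∧ 0 < y ∧ y < 1 := hp
  have hy1' : 0 < 1 - y := sub_pos.2 hy1
  simp only []
  set s : ℕ → ℝ := fun n => Real.sqrt (2 * n) with hs_def
  set h : ℕ → ℕ := fun n => ⌈x * s n⌉₊ with hh_def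
  set i : ℕ → ℕ := fun n => ⌊y * n⌋₊ with hi_def
  set j : ℕ → ℕ := fun n => n - h n - i n with hj_def
  have hnat : Tendsto (fun n : ℕ => (n : ℝ)) atTop atTop := tendsto_natCast_atTop_atTop
  have hs : Tendsto s atTop atTop :=
    Real.tendsto_sqrt_atTop.comp (hnat.const_mul_atTop two_pos)
  have hX : Tendsto (fun n => (h n : ℝ) / s n) atTop (nhds x) :=
    (tendsto_nat_ceil_mul_div_atTop hx.le).comp hs
  have hY : Tendsto (fun n => (i n : ℝ) / n) atTop (nhds y) :=
    (tendsto_nat_floor_mul_div_atTop hy0.le).comp hnat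
  have hh : Tendsto h atTop atTop := tendsto_nat_ceil_atTop.comp (hs.const_mul_atTop hx)
  have hhn : Tendsto (fun n => (h n : ℝ) / n) atTop (nhds 0) := by
    have h1 : Tendsto (fun n => 2 * ((h n : ℝ) / s n) * (s n)⁻¹) atTop (nhds (2 * x * 0)) :=
      (hX.const_mul 2).mul hs.inv_tendsto_atTop
    rw [mul_zero] at h1
    refine h1.congr' ?_
    filter_upwards [eventually_gt_atTop 0] with n hn
    have hn' : (0 : ℝ) < n := by exact_mod_cast hn
    have h2 : s n * s n = 2 * n := Real.mul_self_sqrt (by positivity)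
    have h3 : s n ≠ 0 := by
      have : 0 < s n := by simp only [hs_def]; positivity
      exact this.ne'
    have h4 : (n : ℝ) = s n * s n / 2 := by rw [h2]; ring
    rw [h4]
    field_simp
  have hle : ∀ᶠ n in atTop, 0 < n ∧ h n + i n ≤ n := by
    have h1 := hhn.add hY
    rw [zero_add] at h1
    filter_upwards [eventually_gt_atTop 0, h1.eventually_lt_const hy1] with n hn h2
    have hn' : (0 : ℝ) < n := by exact_mod_cast hn
    rw [← add_div, div_lt_one hn'] at h2
    exact ⟨hn, by exact_mod_cast h2.le⟩
  have hU : Tendsto (fun n => ((h n + 2 * i n : ℕ) : ℝ) / (2 * n)) atTop (nhds y) := by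
    have h1 := (hhn.div_const 2).add hY
    rw [zero_div, zero_add] at h1
    refine h1.congr fun n => ?_
    push_cast
    ring
  have hV : Tendsto (fun n => ((h n + 2 * j n : ℕ) : ℝ) / (2 * n)) atTop (nhds (1 - y)) := by
    refine (hU.const_sub 1).congr' ?_
    filter_upwards [hle] with n hn
    have hn' : (0 : ℝ) < n := by exact_mod_cast hn.1
    have h1 : ((n - h n - i n : ℕ) : ℝ) = n - h n - i n := by
      rw [Nat.cast_sub (by omega), Nat.cast_sub (by omega)]
    push_cast [hj_def]
    rw [h1]
    field_simp
    ring
  have hcr : ∀ (k : ℕ → ℕ) (u : ℝ), 0 < u →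
      Tendsto (fun n => ((h n + 2 * k n : ℕ) : ℝ) / (2 * n)) atTop (nhds u) →
      Tendsto (fun n => chooseRatio (h n + 2 * k n) (k n)) atTop
        (nhds (K * Real.exp (-(x ^ 2 / u) / 2))) := by
    intro k u hu hk
    have h1 := hK h k (x / Real.sqrt u)
      (tendsto_atTop_mono (fun n => Nat.le_add_right _ _) hh) ?_
    · rwa [div_pow, Real.sq_sqrt hu.le] at h1
    · refine (hX.div ((Real.continuous_sqrt.tendsto u).comp hk)
        (Real.sqrt_pos.2 hu).ne').congr' ?_
      filter_upwards [eventually_gt_atTop 0] with n hn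
      have hn' : (0 : ℝ) < n := by exact_mod_cast hn
      have h3 : s n ≠ 0 := by
        have : 0 < s n := by simp only [hs_def]; positivity
        exact this.ne'
      simp only [Function.comp, Pi.div_apply]
      rw [Real.sqrt_div' _ (by positivity), div_div, mul_div_cancel₀ _ h3]
  have hf' : Tendsto (fun n => f ((h n : ℝ) / s n, (i n : ℝ) / n)) atTop (nhds (f (x, y))) :=
    (hf.tendsto _).comp (hX.prodMk_nhds hY)
  have hrp1 : Tendsto (fun n => ((h n : ℝ) / s n) ^ (3 / 2 : ℝ)) atTop
      (nhds (x ^ (3 / 2 : ℝ))) := hX.rpow_const (Or.inl hx.ne')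
  have hrp2 := (hU.mul hV).rpow_const (p := -3 / 2) (Or.inl (mul_pos hy0 hy1').ne')
  have hall := (((((hL.comp hh).mul hrp1).mul hrp2).mul (hcr i y hy0 hU)).mul
    (hcr j (1 - y) hy1' hV)).mul hf'
  have hval : L * x ^ (3 / 2 : ℝ) * (y * (1 - y)) ^ (-3 / 2 : ℝ) *
      (K * Real.exp (-(x ^ 2 / y) / 2)) * (K * Real.exp (-(x ^ 2 / (1 - y)) / 2)) * f (x, y) =
      L * K ^ 2 * (x ^ (3 / 2 : ℝ) * (y * (1 - y)) ^ (-3 / 2 : ℝ) *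
        Real.exp (-(x ^ 2) / (2 * (y * (1 - y))))) * f (x, y) := by
    have h1 : Real.exp (-(x ^ 2) / (2 * (y * (1 - y)))) =
        Real.exp (-(x ^ 2 / y) / 2) * Real.exp (-(x ^ 2 / (1 - y)) / 2) := by
      rw [← Real.exp_add]
      congr 1
      field_simp
      ring
    rw [h1]
    ring
  rw [← hval]
  refine hall.congr' ?_
  filter_upwards [hle, hh.eventually_gt_atTop 0] with n hn hh0
  have h1 : stepFn n f (x, y) = scaledCount n (h n) (i n) *
      f ((h n : ℝ) / s n, (i n : ℝ) / n) := if_pos hn.2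
  rw [h1, scaledCount_eq (j := j n) hh0 (by simp only [hj_def]; omega)]
  rfl

/-- The normalizing constant of the limiting density. -/
noncomputable def rhoConst : ℝ :=
  (2 : ℝ) ^ ((1 : ℝ) / 4) / (Real.Gamma (3 / 4) * Real.sqrt Real.pi)

lemma rhoConst_pos : 0 < rhoConst := by
  have := Real.Gamma_pos_of_pos (show (0 : ℝ) < 3 / 4 by norm_num)
  unfold rhoConst
  positivity

lemma rhoLim_nonneg {p : ℝ × ℝ} (hp : p ∈ strip) : 0 ≤ rhoLim p := by
  have h1 : 0 < p.1 := hp.1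
  have h2 : 0 < p.2 * (1 - p.2) := mul_pos hp.2.1 (sub_pos.2 hp.2.2)
  have h3 := rhoConst_pos
  rw [rhoLim, ← rhoConst]
  positivity

lemma measurable_rhoLim : Measurable rhoLim := by
  unfold rhoLim
  fun_prop

lemma exists_tendsto_stepFn : ∃ C, 0 < C ∧ ∀ f : ℝ × ℝ → ℝ, Continuous f → ∀ p ∈ strip,
    Tendsto (fun n => stepFn n f p) atTop (nhds (C * (rhoLim p * f p))) := by
  obtain ⟨L, hL0, hL⟩ := exists_tendsto_trinomRatio
  obtain ⟨K, hK0, hK⟩ := exists_tendsto_chooseRatio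
  have hc := rhoConst_pos
  refine ⟨L * K ^ 2 / rhoConst, by positivity, fun f hf p hp => ?_⟩
  convert tendsto_stepFn hL hK hf hp using 2
  rw [rhoLim, ← rhoConst]
  field_simp

lemma integrable_rhoLim : Integrable rhoLim (volume.restrict strip) := by
  obtain ⟨C, hC, hlim⟩ := exists_tendsto_stepFn
  obtain ⟨B, hB, hbound⟩ := exists_abs_stepFn_le
  refine ((integrable_strip_bound.const_mul (C⁻¹ * B))).mono'
    measurable_rhoLim.aestronglyMeasurable ?_
  filter_upwards [ae_restrict_mem measurableSet_strip] with p hp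
  have h1 := (hlim (fun _ => 1) continuous_const p hp).abs
  have h2 := le_of_tendsto h1 (by
    filter_upwards [eventually_gt_atTop 0] with n hn
    exact hbound n hn (fun _ => 1) 1 (by simp) p hp)
  rw [mul_one, one_mul, abs_mul, abs_of_pos hC] at h2
  rw [Real.norm_eq_abs, mul_assoc, ← div_eq_inv_mul, le_div_iff₀ hC, mul_comm]
  exact h2

lemma integral_rhoLim_fst {y : ℝ} (hy : y ∈ Set.Ioo (0 : ℝ) 1) :
    ∫ x in Set.Ioi (0 : ℝ), rhoLim (x, y) =
      rhoConst * (2 : ℝ) ^ (1 / 4 : ℝ) * Real.Gamma (5 / 4) * (y * (1 - y)) ^ (3 / 4 - 1 : ℝ) := by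
  have hv : 0 < y * (1 - y) := mul_pos hy.1 (sub_pos.2 hy.2)
  set v := y * (1 - y) with hv_def
  have h := integral_rpow_mul_exp_neg_mul_rpow (p := 2) (q := 3 / 2) (b := 1 / (2 * v))
    (by norm_num) (by norm_num) (by positivity)
  have he : ∀ x : ℝ, rhoLim (x, y) = rhoConst * v ^ (-3 / 2 : ℝ) *
      (x ^ (3 / 2 : ℝ) * Real.exp (-(1 / (2 * v)) * x ^ (2 : ℝ))) := by
    intro x
    have h2 : -(1 / (2 * v)) * x ^ (2 : ℝ) = -(x ^ 2) / (2 * v) := by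
      rw [Real.rpow_two]; ring
    rw [h2, rhoLim, ← rhoConst, ← hv_def]
    ring
  simp_rw [he]
  rw [integral_const_mul, h]
  have h3 : (1 / (2 * v)) ^ (-((3 / 2 : ℝ) + 1) / 2) = 2 * 2 ^ (1 / 4 : ℝ) * v ^ (5 / 4 : ℝ) := by
    rw [one_div, Real.inv_rpow (by positivity), ← Real.rpow_neg (by positivity),
      Real.mul_rpow (by norm_num) hv.le, ← Real.rpow_one_add' (by norm_num) (by norm_num)]
    norm_num
  have h4 : v ^ (3 / 4 - 1 : ℝ) = v ^ (-3 / 2 : ℝ) * v ^ (5 / 4 : ℝ) := by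
    rw [← Real.rpow_add hv]; norm_num
  have h5 : ((3 / 2 : ℝ) + 1) / 2 = 5 / 4 := by norm_num
  rw [h3, h4, h5]
  ring

lemma integral_rhoLim : ∫ p in strip, rhoLim p = 1 := by
  have hfi := integrable_rhoLim
  rw [volume_restrict_strip] at hfi ⊢
  rw [integral_prod_symm _ hfi, setIntegral_congr_fun measurableSet_Ioo
    (fun y hy => integral_rhoLim_fst hy), integral_const_mul,
    (integrableOn_and_integral_mul_one_sub_rpow (a := 3 / 4) (by norm_num)).2]
  have h1 : Real.Gamma (3 / 4 + 3 / 4) = Real.sqrt Real.pi / 2 := by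
    rw [show (3 / 4 + 3 / 4 : ℝ) = 1 / 2 + 1 by norm_num, Real.Gamma_add_one (by norm_num),
      Real.Gamma_one_half_eq]
    ring
  have h2 : Real.Gamma (5 / 4) = Real.Gamma (1 / 4) / 4 := by
    rw [show (5 / 4 : ℝ) = 1 / 4 + 1 by norm_num, Real.Gamma_add_one (by norm_num)]
    ring
  have h3 := Real.Gamma_mul_Gamma_one_sub (1 / 4)
  have h4 : Real.sin (Real.pi * (1 / 4)) = Real.sqrt 2 / 2 := by
    rw [mul_one_div, Real.sin_pi_div_four]
  rw [h4, show (1 - 1 / 4 : ℝ) = 3 / 4 by norm_num] at h3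
  have h5 : (2 : ℝ) ^ (1 / 4 : ℝ) * 2 ^ (1 / 4 : ℝ) = Real.sqrt 2 := by
    rw [Real.sqrt_eq_rpow, ← Real.rpow_add two_pos]; norm_num
  have hG := Real.Gamma_pos_of_pos (show (0 : ℝ) < 3 / 4 by norm_num)
  have hpi := Real.pi_pos
  have hsp := Real.mul_self_sqrt hpi.le
  have hs0 := Real.sqrt_pos.2 hpi
  have h20 : 0 < Real.sqrt 2 := by positivity
  rw [h1, h2, rhoConst]
  rw [eq_div_iff (by positivity)] at h3
  generalize Real.Gamma (3 / 4) = G at *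
  generalize Real.Gamma (1 / 4) = G' at *
  generalize (2 : ℝ) ^ (1 / 4 : ℝ) = t at *
  field_simp
  linear_combination 2 * G * G' * h5 + 4 * h3 - 4 * hsp

lemma exists_tendsto_integral_stepFn : ∃ C, 0 < C ∧
    ∀ f : BoundedContinuousFunction (ℝ × ℝ) ℝ,
      Tendsto (fun n => ∫ p in strip, stepFn n f p) atTop
        (nhds (C * ∫ p in strip, rhoLim p * f p)) := by
  obtain ⟨C, hC, hlim⟩ := exists_tendsto_stepFn
  obtain ⟨B, hB, hbound⟩ := exists_abs_stepFn_le
  refine ⟨C, hC, fun f => ?_⟩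
  rw [← integral_const_mul]
  refine tendsto_integral_filter_of_dominated_convergence _ ?_ ?_
    ((integrable_strip_bound.const_mul B).const_mul ‖f‖) ?_
  · filter_upwards [eventually_gt_atTop 0] with n hn
    exact aestronglyMeasurable_stepFn hn f
  · filter_upwards [eventually_gt_atTop 0] with n hn
    filter_upwards [ae_restrict_mem measurableSet_strip] with p hp
    exact hbound n hn f ‖f‖ f.norm_coe_le_norm p hp
  · filter_upwards [ae_restrict_mem measurableSet_strip] with p hp
    exact hlim f f.continuous p hp

lemma Ncount_nonneg (n h i : ℕ) : 0 ≤ Ncount n h i := by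
  unfold Ncount Fforest
  positivity

lemma Dcount_nonneg (n : ℕ) : 0 ≤ Dcount n :=
  Finset.sum_nonneg fun h _ => Finset.sum_nonneg fun i _ => Ncount_nonneg n h i

lemma integral_muN (n : ℕ) (f : BoundedContinuousFunction (ℝ × ℝ) ℝ) :
    ∫ p, f p ∂(muN n) = (∑ h ∈ Finset.Icc 1 n, ∑ i ∈ Finset.range (n - h + 1),
      Ncount n h i * f (h / Real.sqrt (2 * n), i / n)) / Dcount n := by
  have hfi : ∀ h i : ℕ, Integrable f ((ENNReal.ofReal (Ncount n h i / Dcount n)) •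
      Measure.dirac (((h : ℝ) / Real.sqrt (2 * n), (i : ℝ) / n) : ℝ × ℝ)) := fun h i =>
    (f.integrable _).smul_measure ENNReal.ofReal_ne_top
  rw [muN, integral_finsetSum_measure
    (fun h _ => integrable_finsetSum_measure.2 fun i _ => hfi h i), Finset.sum_div]
  refine Finset.sum_congr rfl fun h _ => ?_
  rw [integral_finsetSum_measure (fun i _ => hfi h i), Finset.sum_div]
  refine Finset.sum_congr rfl fun i _ => ?_
  rw [integral_smul_measure, integral_dirac, ENNReal.toReal_ofReal
    (div_nonneg (Ncount_nonneg _ _ _) (Dcount_nonneg _)), smul_eq_mul, div_mul_eq_mul_div]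

lemma integral_muN_eq_div {n : ℕ} (hn : 0 < n) (f : BoundedContinuousFunction (ℝ × ℝ) ℝ) :
    ∫ p, f p ∂(muN n) = (∫ p in strip, stepFn n f p) / ∫ p in strip, stepFn n (fun _ => 1) p := by
  have hn' : (0 : ℝ) < n := by exact_mod_cast hn
  have hs : 0 < Real.sqrt (2 * n) := by positivity
  have hfac : ∀ g : ℝ × ℝ → ℝ, ∫ p in strip, stepFn n g p =
      (1 / (Real.sqrt (2 * n) * n) * ((2 * n : ℝ) ^ (9 / 4 : ℝ) / 12 ^ n)) *
      ∑ h ∈ Finset.Icc 1 n, ∑ i ∈ Finset.range (n - h + 1),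
        Ncount n h i * g (h / Real.sqrt (2 * n), i / n) := by
    intro g
    rw [integral_stepFn hn, mul_assoc]
    congr 1
    simp_rw [Finset.mul_sum, scaledCount]
    refine Finset.sum_congr rfl fun h _ => Finset.sum_congr rfl fun i _ => ?_
    ring
  rw [hfac, hfac, mul_div_mul_left _ _ (by positivity), integral_muN]
  simp only [mul_one, Dcount]

lemma integral_muLim (f : ℝ × ℝ → ℝ) :
    ∫ p, f p ∂muLim = ∫ p in strip, rhoLim p * f p := by
  rw [muLim, ← strip, integral_withDensity_eq_integral_toReal_smul
    measurable_rhoLim.ennreal_ofReal (Eventually.of_forall fun _ => ENNReal.ofReal_lt_top)]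
  refine setIntegral_congr_fun measurableSet_strip fun p hp => ?_
  simp only [smul_eq_mul]
  rw [ENNReal.toReal_ofReal (rhoLim_nonneg hp)]

/-- Weak convergence of the joint law of the rescaled cycle length and external
area of a uniform pointed well-labelled unicycle: for every bounded continuous
function `f` on `ℝ²`, `∫ f dμ_n → ∫ f dμ`. -/
theorem weak_convergence_length_area :
    ∀ f : BoundedContinuousFunction (ℝ × ℝ) ℝ,
      Tendsto (fun n : ℕ => ∫ p, f p ∂(muN n)) atTop (nhds (∫ p, f p ∂muLim)) := by
  intro f
  obtain ⟨C, hC, hlim⟩ := exists_tendsto_integral_stepFn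
  have h1 := hlim (BoundedContinuousFunction.const _ 1)
  simp only [BoundedContinuousFunction.const_apply, mul_one, integral_rhoLim] at h1
  have h2 := (hlim f).div h1 hC.ne'
  rw [mul_div_cancel_left₀ _ hC.ne', ← integral_muLim] at h2
  refine h2.congr' ?_
  filter_upwards [eventually_gt_atTop 0] with n hn
  exact (integral_muN_eq_div hn f).symm
end

section
/- The function (x,y) ↦ (2^{1/4}/(Γ(3/4)·√π))·x^{3/2}·(y(1−y))^{−3/2}·exp(−x²/(2y(1−y))) is a probability density on (0,∞)×(0,1); equivalently, ∫_{0}^{∞} ∫_{0}^{1} x^{3/2}·(y(1−y))^{−3/2}·exp(−x²/(2y(1−y))) dy dx = 2^{−1/4}·Γ(3/4)·√π. -/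
open MeasureTheory Set in
theorem re_beta_integrand (u v : ℝ) {x : ℝ} (hx : x ∈ Ioo (0 : ℝ) 1) :
    ((x : ℂ) ^ ((u : ℂ) - 1) * (1 - (x : ℂ)) ^ ((v : ℂ) - 1)).re =
      x ^ (u - 1) * (1 - x) ^ (v - 1) := by
  norm_cast
  rw [← Complex.ofReal_cpow hx.1.le, ← Complex.ofReal_cpow (by linarith [hx.2]),
    Complex.re_mul_ofReal, Complex.ofReal_re]

open MeasureTheory Set in
theorem integrableOn_complex_beta_integrand {u v : ℝ} (hu : 0 < u) (hv : 0 < v) :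
    IntegrableOn (fun x : ℝ => (x : ℂ) ^ ((u : ℂ) - 1) * (1 - (x : ℂ)) ^ ((v : ℂ) - 1))
      (Ioo 0 1) := by
  have h := Complex.betaIntegral_convergent (u := u) (v := v) (by simpa) (by simpa)
  rw [intervalIntegrable_iff_integrableOn_Ioc_of_le (by simp)] at h
  exact h.mono_set Ioo_subset_Ioc_self

open MeasureTheory Set in
theorem integrableOn_rpow_mul_one_sub_rpow {u v : ℝ} (hu : 0 < u) (hv : 0 < v) :
    IntegrableOn (fun x : ℝ => x ^ (u - 1) * (1 - x) ^ (v - 1)) (Ioo 0 1) :=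
  IntegrableOn.congr_fun (integrableOn_complex_beta_integrand hu hv).re
    (fun _ hx => re_beta_integrand u v hx) measurableSet_Ioo

open MeasureTheory Set in
theorem integral_rpow_mul_one_sub_rpow {u v : ℝ} (hu : 0 < u) (hv : 0 < v) :
    ∫ x in Ioo (0 : ℝ) 1, x ^ (u - 1) * (1 - x) ^ (v - 1) =
      Real.Gamma u * Real.Gamma v / Real.Gamma (u + v) := by
  have h := ProbabilityTheory.beta_eq_betaIntegralReal u v hu hv
  rw [ProbabilityTheory.beta] at h
  rw [h, Complex.betaIntegral, intervalIntegral.integral_of_le zero_le_one,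
    integral_Ioc_eq_integral_Ioo, ← RCLike.re_to_complex,
    ← integral_re (integrableOn_complex_beta_integrand hu hv)]
  exact setIntegral_congr_fun measurableSet_Ioo fun x hx => (re_beta_integrand u v hx).symm

open MeasureTheory Set in
theorem integrableOn_rpow_mul_rpow_mul_exp {u : ℝ} (hu : 0 < u) :
    IntegrableOn (fun x : ℝ =>
      x ^ ((3 : ℝ) / 2) * u ^ (-(3 : ℝ) / 2) * Real.exp (-(x ^ 2) / (2 * u))) (Ioi 0) := by
  have h := (integrableOn_rpow_mul_exp_neg_mul_rpow (p := 2) (s := 3 / 2) (b := (2 * u)⁻¹)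
    (by norm_num) two_pos (by positivity)).const_mul (u ^ (-(3 : ℝ) / 2))
  refine IntegrableOn.congr_fun h (fun x _ => ?_) measurableSet_Ioi
  have : -(2 * u)⁻¹ * x ^ (2 : ℝ) = -(x ^ 2) / (2 * u) := by
    rw [Real.rpow_two]; ring
  simp only [this]
  ring

open MeasureTheory Set in
theorem integral_rpow_mul_rpow_mul_exp {u : ℝ} (hu : 0 < u) :
    ∫ x in Ioi (0 : ℝ),
      x ^ ((3 : ℝ) / 2) * u ^ (-(3 : ℝ) / 2) * Real.exp (-(x ^ 2) / (2 * u)) =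
      2 ^ ((1 : ℝ) / 4) * Real.Gamma (5 / 4) * u ^ (-(1 : ℝ) / 4) := by
  have h := integral_rpow_mul_exp_neg_mul_rpow (p := 2) (q := 3 / 2) (b := (2 * u)⁻¹)
    two_pos (by norm_num) (by positivity)
  have e : ∀ x : ℝ, x ^ ((3 : ℝ) / 2) * u ^ (-(3 : ℝ) / 2) * Real.exp (-(x ^ 2) / (2 * u)) =
      u ^ (-(3 : ℝ) / 2) * (x ^ ((3 : ℝ) / 2) * Real.exp (-(2 * u)⁻¹ * x ^ (2 : ℝ))) := by
    intro x
    have : -(2 * u)⁻¹ * x ^ (2 : ℝ) = -(x ^ 2) / (2 * u) := by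
      rw [Real.rpow_two]; ring
    rw [this]
    ring
  simp_rw [e]
  rw [integral_const_mul, h, Real.inv_rpow (by positivity), ← Real.rpow_neg (by positivity),
    Real.mul_rpow two_pos.le hu.le,
    show -(-((3 : ℝ) / 2 + 1) / 2) = 1 / 4 + 1 by norm_num, Real.rpow_add two_pos, Real.rpow_one,
    show ((3 : ℝ) / 2 + 1) / 2 = 5 / 4 by norm_num,
    show -(1 : ℝ) / 4 = -3 / 2 + (1 / 4 + 1) by norm_num, Real.rpow_add hu (-3 / 2)]
  ring

open MeasureTheory Set in
theorem integrable_density :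
    Integrable (Function.uncurry fun x y : ℝ =>
      x ^ ((3 : ℝ) / 2) * (y * (1 - y)) ^ (-(3 : ℝ) / 2) *
        Real.exp (-(x ^ 2) / (2 * (y * (1 - y)))))
      ((volume.restrict (Ioi 0)).prod (volume.restrict (Ioo 0 1))) := by
  have hpos : ∀ y ∈ Ioo (0 : ℝ) 1, 0 < y * (1 - y) := fun y hy =>
    mul_pos hy.1 (sub_pos.2 hy.2)
  rw [integrable_prod_iff' (Measurable.aestronglyMeasurable (by
    unfold Function.uncurry; fun_prop))]
  refine ⟨ae_restrict_of_forall_mem measurableSet_Ioo fun y hy =>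
    integrableOn_rpow_mul_rpow_mul_exp (hpos y hy), ?_⟩
  refine IntegrableOn.congr_fun ((integrableOn_rpow_mul_one_sub_rpow (u := 3 / 4) (v := 3 / 4)
    (by norm_num) (by norm_num)).const_mul (2 ^ ((1 : ℝ) / 4) * Real.Gamma (5 / 4)))
    (fun y hy => ?_) measurableSet_Ioo
  have hu := hpos y hy
  have e := integral_rpow_mul_rpow_mul_exp hu
  rw [Real.mul_rpow (z := -(1 : ℝ) / 4) hy.1.le (sub_pos.2 hy.2).le] at e
  norm_num only at e ⊢
  rw [← e]
  refine setIntegral_congr_fun measurableSet_Ioi fun x hx => ?_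
  have hx' : (0 : ℝ) < x := hx
  simp only [Function.uncurry]
  rw [Real.norm_of_nonneg (by positivity)]

theorem gamma_constants :
    2 ^ ((1 : ℝ) / 4) * Real.Gamma (5 / 4) *
      (Real.Gamma (3 / 4) * Real.Gamma (3 / 4) / Real.Gamma (3 / 4 + 3 / 4)) =
      (2 : ℝ) ^ (-(1 : ℝ) / 4) * Real.Gamma (3 / 4) * Real.sqrt Real.pi := by
  have h₁ : Real.Gamma (5 / 4) = 1 / 4 * Real.Gamma (1 / 4) := by
    rw [← Real.Gamma_add_one (by norm_num)]; norm_num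
  have h₂ : Real.Gamma (3 / 4 + 3 / 4) = 1 / 2 * Real.sqrt Real.pi := by
    rw [← Real.Gamma_one_half_eq, ← Real.Gamma_add_one (by norm_num)]; norm_num
  have h₃ : Real.Gamma (1 / 4) * Real.Gamma (3 / 4) = Real.pi * Real.sqrt 2 := by
    have h := Real.Gamma_mul_Gamma_one_sub (1 / 4)
    rw [mul_one_div, Real.sin_pi_div_four, show (1 : ℝ) - 1 / 4 = 3 / 4 by norm_num] at h
    rw [h]
    field_simp
    norm_num
  have h₄ : (2 : ℝ) ^ ((1 : ℝ) / 4) * Real.sqrt 2 = 2 * 2 ^ (-(1 : ℝ) / 4) := by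
    rw [Real.sqrt_eq_rpow, ← Real.rpow_add two_pos, ← Real.rpow_one_add' two_pos.le (by norm_num)]
    norm_num
  have hs : Real.sqrt Real.pi * Real.sqrt Real.pi = Real.pi :=
    Real.mul_self_sqrt Real.pi_pos.le
  have hs₀ : Real.sqrt Real.pi ≠ 0 := (Real.sqrt_pos.2 Real.pi_pos).ne'
  rw [h₁, h₂]
  calc _ = (2 : ℝ) ^ ((1 : ℝ) / 4) * (Real.Gamma (1 / 4) * Real.Gamma (3 / 4)) *
        Real.Gamma (3 / 4) / (2 * Real.sqrt Real.pi) := by field_simp; norm_num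
    _ = ((2 : ℝ) ^ ((1 : ℝ) / 4) * Real.sqrt 2) * Real.Gamma (3 / 4) *
        (Real.sqrt Real.pi * Real.sqrt Real.pi) / (2 * Real.sqrt Real.pi) := by
      rw [h₃, hs]; ring
    _ = _ := by rw [h₄]; field_simp


/-- The normalization of the limiting joint density of the rescaled cycle length
and external area of a uniform pointed well-labelled unicycle:
`∫_0^∞ ∫_0^1 x^{3/2} (y(1-y))^{-3/2} exp(-x²/(2y(1-y))) dy dx = 2^{-1/4} Γ(3/4) √π`. -/
theorem density_normalization :
    (∫ x in Set.Ioi (0 : ℝ), ∫ y in Set.Ioo (0 : ℝ) 1,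
        x ^ ((3 : ℝ) / 2) * (y * (1 - y)) ^ (-(3 : ℝ) / 2) *
          Real.exp (-(x ^ 2) / (2 * (y * (1 - y))))) =
      (2 : ℝ) ^ (-(1 : ℝ) / 4) * Real.Gamma (3 / 4) * Real.sqrt Real.pi := by
  rw [MeasureTheory.integral_integral_swap integrable_density, ← gamma_constants,
    ← integral_rpow_mul_one_sub_rpow (by norm_num) (by norm_num),
    ← MeasureTheory.integral_const_mul]
  refine MeasureTheory.setIntegral_congr_fun measurableSet_Ioo fun y hy => ?_
  have hy₁ : 0 < 1 - y := sub_pos.2 hy.2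
  rw [integral_rpow_mul_rpow_mul_exp (mul_pos hy.1 hy₁), Real.mul_rpow hy.1.le hy₁.le]
  norm_num
end

section
/- For every x > 0 and a > 0, ∫_{0}^{a} (y(a−y))^{−3/2}·exp(−a·x²/(2y(a−y))) dy = (2·√(2π)/(x·a^{3/2}))·exp(−2x²/a). (Equivalently, the convolution identity ∫_0^a q_x(y)·q_x(a−y) dy = q_{2x}(a) for the Brownian first-hitting-time densities q_x(t) = (x/√(2πt³))·exp(−x²/(2t)).) -/
open MeasureTheory Set

theorem hasDerivAt_div_sqrt_one_add_sq (w : ℝ) :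
    HasDerivAt (fun w : ℝ => w / √(1 + w ^ 2)) (1 / √(1 + w ^ 2) ^ 3) w := by
  have hpos : 0 < 1 + w ^ 2 := by positivity
  have hr : 0 < √(1 + w ^ 2) := Real.sqrt_pos.2 hpos
  have hsq : √(1 + w ^ 2) ^ 2 = 1 + w ^ 2 := Real.sq_sqrt hpos.le
  have h := (hasDerivAt_id w).div ((((hasDerivAt_id w).pow 2).const_add 1).sqrt hpos.ne') hr.ne'
  refine h.congr_deriv ?_
  simp only [id, Pi.pow_apply]
  field_simp
  rw [hsq]
  push_cast
  ring

theorem image_affine_div_sqrt_one_add_sq {a : ℝ} (ha : 0 < a) :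
    (fun w : ℝ => a / 2 + a / 2 * (w / √(1 + w ^ 2))) '' univ = Ioo 0 a := by
  ext y
  simp only [image_univ, mem_range, mem_Ioo]
  constructor
  · rintro ⟨w, rfl⟩
    have hr : 0 < √(1 + w ^ 2) := Real.sqrt_pos.2 (by positivity)
    have habs : |w| < √(1 + w ^ 2) := by
      rw [← Real.sqrt_sq_eq_abs]
      exact Real.sqrt_lt_sqrt (sq_nonneg w) (by linarith)
    obtain ⟨h1, h2⟩ := abs_lt.1 habs
    have h3 : -1 < w / √(1 + w ^ 2) := by rw [lt_div_iff₀ hr]; linarith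
    have h4 : w / √(1 + w ^ 2) < 1 := by rw [div_lt_one hr]; exact h2
    constructor <;> nlinarith
  · rintro ⟨h0, h1⟩
    have hp : 0 < y * (a - y) := mul_pos h0 (sub_pos.2 h1)
    have hq : 0 < √(y * (a - y)) := Real.sqrt_pos.2 hp
    have hsq : √(y * (a - y)) ^ 2 = y * (a - y) := Real.sq_sqrt hp.le
    refine ⟨(y - a / 2) / √(y * (a - y)), ?_⟩
    have hs : √(1 + ((y - a / 2) / √(y * (a - y))) ^ 2) = a / (2 * √(y * (a - y))) := by
      rw [Real.sqrt_eq_iff_mul_self_eq (by positivity) (by positivity)]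
      field_simp
      rw [hsq]
      ring
    rw [hs]
    field_simp
    ring

/-- The semigroup (convolution) identity for Brownian first-hitting-time densities:
for `x > 0` and `a > 0`,
`∫_0^a (y(a-y))^{-3/2} exp(-a x²/(2y(a-y))) dy = (2√(2π)/(x a^{3/2})) exp(-2x²/a)`. -/
theorem hitting_time_convolution (x a : ℝ) (hx : 0 < x) (ha : 0 < a) :
    (∫ y in Set.Ioo (0 : ℝ) a,
        (y * (a - y)) ^ (-(3 : ℝ) / 2) * Real.exp (-(a * x ^ 2) / (2 * (y * (a - y))))) =
      2 * Real.sqrt (2 * Real.pi) / (x * a ^ ((3 : ℝ) / 2)) *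
        Real.exp (-(2 * x ^ 2) / a) := by
  have hderiv (w : ℝ) : HasDerivAt (fun w : ℝ => a / 2 + a / 2 * (w / √(1 + w ^ 2)))
      (a / 2 * (1 / √(1 + w ^ 2) ^ 3)) w :=
    ((hasDerivAt_div_sqrt_one_add_sq w).const_mul _).const_add _
  have hmono : Monotone (fun w : ℝ => a / 2 + a / 2 * (w / √(1 + w ^ 2))) :=
    monotone_of_deriv_nonneg (fun w => (hderiv w).differentiableAt)
      fun w => by rw [(hderiv w).deriv]; positivity
  have hcongr (w : ℝ) : (a / 2 * (1 / √(1 + w ^ 2) ^ 3)) •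
      (((a / 2 + a / 2 * (w / √(1 + w ^ 2))) *
          (a - (a / 2 + a / 2 * (w / √(1 + w ^ 2))))) ^ (-(3 : ℝ) / 2) *
        Real.exp (-(a * x ^ 2) / (2 * ((a / 2 + a / 2 * (w / √(1 + w ^ 2))) *
          (a - (a / 2 + a / 2 * (w / √(1 + w ^ 2)))))))) =
      4 / a ^ 2 * Real.exp (-(2 * x ^ 2) / a) * Real.exp (-(2 * x ^ 2 / a) * w ^ 2) := by
    have hpos : 0 < 1 + w ^ 2 := by positivity
    have hr : 0 < √(1 + w ^ 2) := Real.sqrt_pos.2 hpos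
    have hsq : √(1 + w ^ 2) ^ 2 = 1 + w ^ 2 := Real.sq_sqrt hpos.le
    have hprod : (a / 2 + a / 2 * (w / √(1 + w ^ 2))) *
        (a - (a / 2 + a / 2 * (w / √(1 + w ^ 2)))) = (a / (2 * √(1 + w ^ 2))) ^ 2 := by
      field_simp
      linear_combination hsq
    have hpow : ((a / (2 * √(1 + w ^ 2))) ^ 2) ^ (-(3 : ℝ) / 2) =
        ((a / (2 * √(1 + w ^ 2))) ^ 3)⁻¹ := by
      rw [← Real.rpow_natCast_mul (by positivity),
        show ((2 : ℕ) : ℝ) * (-(3 : ℝ) / 2) = -((3 : ℕ) : ℝ) by norm_num,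
        Real.rpow_neg (by positivity), Real.rpow_natCast]
    have hexp : -(a * x ^ 2) / (2 * (a / (2 * √(1 + w ^ 2))) ^ 2) =
        -(2 * x ^ 2) / a + -(2 * x ^ 2 / a) * w ^ 2 := by
      field_simp
      rw [hsq]
      ring
    rw [hprod, hpow, hexp, Real.exp_add, smul_eq_mul]
    field_simp
    norm_num
  rw [← image_affine_div_sqrt_one_add_sq ha,
    integral_image_eq_integral_deriv_smul_of_monotoneOn MeasurableSet.univ
      (fun w _ => (hderiv w).hasDerivWithinAt) (hmono.monotoneOn _)]
  simp only [hcongr, Measure.restrict_univ]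
  rw [integral_const_mul, integral_gaussian]
  have hsqrt : √(Real.pi / (2 * x ^ 2 / a)) = √(2 * Real.pi) * √a / (2 * x) := by
    rw [Real.sqrt_eq_iff_mul_self_eq (by positivity) (by positivity)]
    have h1 : √(Real.pi * 2) ^ 2 = Real.pi * 2 := Real.sq_sqrt (by positivity)
    have h2 : √a ^ 2 = a := Real.sq_sqrt ha.le
    field_simp
    rw [h1, h2]
  have hapow : a ^ ((3 : ℝ) / 2) = √a ^ 3 := by
    rw [Real.sqrt_eq_rpow, ← Real.rpow_mul_natCast ha.le]
    norm_num
  have ha4 : √a ^ 4 = a ^ 2 := by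
    rw [show √a ^ 4 = (√a ^ 2) ^ 2 by ring, Real.sq_sqrt ha.le]
  rw [hsqrt, hapow, ← ha4]
  have := Real.sqrt_pos.2 ha
  field_simp
  norm_num
end

section
/- For every a > 0, ∫_{0}^{∞} ∫_{0}^{a} x^{1/2}·(y(a−y))^{−3/2}·exp(−a·x²/(2y(a−y))) dy dx = 2^{1/4}·Γ(1/4)·√π / a^{5/4}. In particular, the function (x,y) ↦ (a^{5/4}/(2^{1/4}·Γ(1/4)·√π))·x^{1/2}·(y(a−y))^{−3/2}·exp(−a·x²/(2y(a−y))) is a probability density on (0,∞)×(0,a). -/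
open MeasureTheory Set

theorem integral_Ioo_rpow_mul_sub_rpow {s t a : ℝ} (hs : 0 < s) (ht : 0 < t) (ha : 0 < a) :
    ∫ y in Ioo 0 a, y ^ (s - 1) * (a - y) ^ (t - 1) =
      a ^ (s + t - 1) * ProbabilityTheory.beta s t := by
  apply Complex.ofReal_injective
  have h := Complex.betaIntegral_scaled s t ha
  rw [Complex.betaIntegral_eq_Gamma_mul_div _ _ (by simpa) (by simpa),
    intervalIntegral.integral_of_le ha.le, integral_Ioc_eq_integral_Ioo] at h
  have hr : ((a ^ (s + t - 1) * ProbabilityTheory.beta s t : ℝ) : ℂ) =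
      (a : ℂ) ^ ((s : ℂ) + t - 1) * (Complex.Gamma s * Complex.Gamma t / Complex.Gamma (s + t)) := by
    simp_rw [ProbabilityTheory.beta, ← Complex.ofReal_add, Complex.Gamma_ofReal]
    push_cast [Complex.ofReal_cpow ha.le]
    rfl
  rw [hr, ← h, ← integral_complex_ofReal]
  refine setIntegral_congr_fun measurableSet_Ioo fun y hy => ?_
  push_cast [Complex.ofReal_cpow hy.1.le, Complex.ofReal_cpow (sub_nonneg.2 hy.2.le)]
  rfl

theorem integrableOn_Ioo_rpow_mul_sub_rpow {s t a : ℝ} (hs : 0 < s) (ht : 0 < t) (ha : 0 < a) :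
    IntegrableOn (fun y => y ^ (s - 1) * (a - y) ^ (t - 1)) (Ioo 0 a) := by
  by_contra h
  have hzero := integral_undef h
  rw [integral_Ioo_rpow_mul_sub_rpow hs ht ha] at hzero
  have := ProbabilityTheory.beta_pos hs ht
  exact (show a ^ (s + t - 1) * ProbabilityTheory.beta s t ≠ 0 by positivity) hzero

theorem integral_Ioi_rpow_mul_exp_neg_mul_sq {q b : ℝ} (hq : -1 < q) (hb : 0 < b) :
    ∫ x in Ioi (0 : ℝ), x ^ q * Real.exp (-b * x ^ 2) =
      b ^ (-(q + 1) / 2) * (1 / 2) * Real.Gamma ((q + 1) / 2) := by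
  simpa using integral_rpow_mul_exp_neg_mul_rpow two_pos hq hb

/-- The joint density of the boundary length `x` and the volume `y`, up to normalization. -/
noncomputable def lengthVolumeKernel (a x y : ℝ) : ℝ :=
  x ^ ((1 : ℝ) / 2) * (y * (a - y)) ^ (-(3 : ℝ) / 2) *
    Real.exp (-(a * x ^ 2) / (2 * (y * (a - y))))

theorem lengthVolumeKernel_eq (a x y : ℝ) :
    lengthVolumeKernel a x y = (y * (a - y)) ^ (-(3 : ℝ) / 2) *
      (x ^ ((1 : ℝ) / 2) * Real.exp (-(a / (2 * (y * (a - y)))) * x ^ 2)) := by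
  rw [lengthVolumeKernel, show -(a * x ^ 2) / (2 * (y * (a - y))) =
    -(a / (2 * (y * (a - y)))) * x ^ 2 by ring]
  ring

theorem integrableOn_lengthVolumeKernel_left {a y : ℝ} (hy : y ∈ Ioo 0 a) :
    IntegrableOn (fun x => lengthVolumeKernel a x y) (Ioi 0) := by
  have hw : 0 < y * (a - y) := mul_pos hy.1 (sub_pos.2 hy.2)
  have ha : 0 < a := hy.1.trans hy.2
  simp_rw [lengthVolumeKernel_eq]
  exact (integrableOn_rpow_mul_exp_neg_mul_sq (by positivity) (by norm_num)).const_mul _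

theorem integral_lengthVolumeKernel_left {a y : ℝ} (hy : y ∈ Ioo 0 a) :
    ∫ x in Ioi 0, lengthVolumeKernel a x y =
      (2 / a) ^ ((3 : ℝ) / 4) * (1 / 2) * Real.Gamma (3 / 4) *
        (y ^ ((1 : ℝ) / 4 - 1) * (a - y) ^ ((1 : ℝ) / 4 - 1)) := by
  have hay : 0 < a - y := sub_pos.2 hy.2
  have hw : 0 < y * (a - y) := mul_pos hy.1 hay
  have ha : 0 < a := hy.1.trans hy.2
  simp_rw [lengthVolumeKernel_eq]
  rw [integral_const_mul, integral_Ioi_rpow_mul_exp_neg_mul_sq (by norm_num) (by positivity),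
    ← Real.mul_rpow hy.1.le hay.le,
    show a / (2 * (y * (a - y))) = ((2 / a) * (y * (a - y)))⁻¹ by field_simp,
    Real.inv_rpow (by positivity), ← Real.rpow_neg (by positivity),
    Real.mul_rpow (by positivity) hw.le,
    show (y * (a - y)) ^ ((1 : ℝ) / 4 - 1) =
      (y * (a - y)) ^ (-(3 : ℝ) / 2) * (y * (a - y)) ^ ((3 : ℝ) / 4) by
        rw [← Real.rpow_add hw]; norm_num]
  norm_num
  ring

theorem integrable_lengthVolumeKernel {a : ℝ} (ha : 0 < a) :
    Integrable (Function.uncurry (lengthVolumeKernel a))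
      ((volume.restrict (Ioi 0)).prod (volume.restrict (Ioo 0 a))) := by
  have hm : Measurable (Function.uncurry (lengthVolumeKernel a)) := by
    unfold Function.uncurry lengthVolumeKernel
    fun_prop
  refine (integrable_prod_iff' hm.aestronglyMeasurable).2
    ⟨ae_restrict_of_forall_mem measurableSet_Ioo fun y hy =>
      integrableOn_lengthVolumeKernel_left hy, ?_⟩
  refine ((integrableOn_Ioo_rpow_mul_sub_rpow (s := 1 / 4) (t := 1 / 4) (by norm_num)
    (by norm_num) ha).const_mul ((2 / a) ^ ((3 : ℝ) / 4) * (1 / 2) * Real.Gamma (3 / 4))).congr ?_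
  refine ae_restrict_of_forall_mem measurableSet_Ioo fun y hy => ?_
  refine (integral_lengthVolumeKernel_left hy).symm.trans ?_
  refine setIntegral_congr_fun measurableSet_Ioi fun x hx => ?_
  have hx : 0 < x := hx
  have hw : 0 < y * (a - y) := mul_pos hy.1 (sub_pos.2 hy.2)
  refine (Real.norm_of_nonneg ?_).symm
  simp only [lengthVolumeKernel]
  positivity

theorem Real.Gamma_one_fourth_mul_Gamma_three_fourths :
    Real.Gamma (1 / 4) * Real.Gamma (3 / 4) = Real.pi * Real.sqrt 2 := by
  have h := Real.Gamma_mul_Gamma_one_sub (1 / 4)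
  rw [show (1 : ℝ) - 1 / 4 = 3 / 4 by norm_num, show Real.pi * (1 / 4) = Real.pi / 4 by ring,
    Real.sin_pi_div_four] at h
  rw [h]
  field_simp
  norm_num

/-- Normalization of the joint law of the boundary length and volume of a delayed
Voronoï cell in the biased Brownian sphere of total volume `a`:
`∫_0^∞ ∫_0^a x^{1/2} (y(a-y))^{-3/2} exp(-a x²/(2y(a-y))) dy dx = 2^{1/4} Γ(1/4) √π / a^{5/4}`. -/
theorem length_volume_normalization (a : ℝ) (ha : 0 < a) :
    (∫ x in Set.Ioi (0 : ℝ), ∫ y in Set.Ioo (0 : ℝ) a,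
        x ^ ((1 : ℝ) / 2) * (y * (a - y)) ^ (-(3 : ℝ) / 2) *
          Real.exp (-(a * x ^ 2) / (2 * (y * (a - y))))) =
      (2 : ℝ) ^ ((1 : ℝ) / 4) * Real.Gamma (1 / 4) * Real.sqrt Real.pi / a ^ ((5 : ℝ) / 4) := by
  change ∫ x in Ioi 0, ∫ y in Ioo 0 a, lengthVolumeKernel a x y = _
  rw [integral_integral_swap (integrable_lengthVolumeKernel ha),
    setIntegral_congr_fun measurableSet_Ioo fun y hy => integral_lengthVolumeKernel_left hy,
    integral_const_mul, integral_Ioo_rpow_mul_sub_rpow (by norm_num) (by norm_num) ha,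
    ProbabilityTheory.beta, show (1 : ℝ) / 4 + 1 / 4 = 1 / 2 by norm_num, Real.Gamma_one_half_eq,
    Real.div_rpow two_pos.le ha.le]
  have h2 : (2 : ℝ) ^ ((3 : ℝ) / 4) * Real.sqrt 2 = 2 * 2 ^ ((1 : ℝ) / 4) := by
    rw [Real.sqrt_eq_rpow, ← Real.rpow_add two_pos, ← Real.rpow_one_add' two_pos.le (by norm_num)]
    norm_num
  have hapow : a ^ ((1 : ℝ) / 2 - 1) * a ^ ((5 : ℝ) / 4) = a ^ ((3 : ℝ) / 4) := by
    rw [← Real.rpow_add ha]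
    norm_num
  have hpi : Real.sqrt Real.pi * Real.sqrt Real.pi = Real.pi := Real.mul_self_sqrt Real.pi_pos.le
  have hG := Real.Gamma_one_fourth_mul_Gamma_three_fourths
  have hpi0 : 0 < Real.sqrt Real.pi := Real.sqrt_pos.2 Real.pi_pos
  have h5 : 0 < a ^ ((5 : ℝ) / 4) := by positivity
  have h3 : 0 < a ^ ((3 : ℝ) / 4) := by positivity
  rw [eq_div_iff h5.ne']
  calc _ = 2 ^ ((3 : ℝ) / 4) * (1 / 2) * (Real.Gamma (1 / 4) * Real.Gamma (3 / 4)) *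
        Real.Gamma (1 / 4) * (a ^ ((1 : ℝ) / 2 - 1) * a ^ ((5 : ℝ) / 4)) /
          (a ^ ((3 : ℝ) / 4) * Real.sqrt Real.pi) := by
        field_simp
    _ = (2 ^ ((3 : ℝ) / 4) * Real.sqrt 2) * (1 / 2) * Real.Gamma (1 / 4) *
        (Real.pi / Real.sqrt Real.pi) := by
        rw [hapow, hG]
        field_simp
    _ = _ := by
        rw [h2, Real.div_sqrt]
        ring
end

section
/- For every δ > 0 there exists M > 0 such that for all n ≥ 1, 2·∑_{k=1}^{⌊√(2n)/M⌋} t_k·3^{n−k}·C(2n, n−k) ≤ δ·√(2n)·b_n, where b_n = (1/n)·∑_{k=1}^{n} k·t_k·3^{n−k}·C(2n, n−k). (Probabilistically: the family of random variables √(2n)/L_n^•, where L_n^• is the cycle length of a uniform pointed well-labelled unicycle with n edges, is uniformly integrable.) -/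
/-- `b_n = (1/n) ∑_{k=1}^n k t_k 3^{n-k} C(2n, n-k)`, the number of
well-labelled unicycles with `n` edges and a distinguished oriented edge on the cycle. -/
noncomputable def bSeq (n : ℕ) : ℝ :=
  (1 / (n : ℝ)) * ∑ k ∈ Finset.Icc 1 n,
    (k : ℝ) * (trinom k : ℝ) * (3 : ℝ) ^ (n - k) * (Nat.choose (2 * n) (n - k) : ℝ)

/-- The number of sequences in `{-1,0,1}^k` with sum `j`. -/
def trinomCoeff (k : ℕ) (j : ℤ) : ℕ :=
  (Finset.univ.filter (fun s : Fin k → Fin 3 => (∑ i, ((s i : ℤ) - 1)) = j)).card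

theorem trinomCoeff_zero_right (k : ℕ) : trinomCoeff k 0 = trinom k := rfl

theorem trinomCoeff_zero_left (j : ℤ) : trinomCoeff 0 j = if j = 0 then 1 else 0 := by
  unfold trinomCoeff
  by_cases hj : j = 0
  · simp [hj]
  · simp [hj, Ne.symm hj]

theorem trinomCoeff_succ (k : ℕ) (j : ℤ) :
    trinomCoeff (k + 1) j
      = trinomCoeff k (j + 1) + trinomCoeff k j + trinomCoeff k (j - 1) := by
  simp only [trinomCoeff, Finset.card_filter]
  rw [← (Fin.consEquiv (fun _ : Fin (k + 1) => Fin 3)).sum_comp, Fintype.sum_prod_type,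
    Fin.sum_univ_three]
  simp only [Fin.consEquiv_apply, Fin.sum_univ_succ, Fin.cons_zero, Fin.cons_succ]
  congr 1
  · congr 1
    · refine Finset.sum_congr rfl fun s _ => if_congr ?_ rfl rfl
      simp only [Fin.val_zero, Nat.cast_zero]
      constructor <;> intro h <;> linarith
    · refine Finset.sum_congr rfl fun s _ => if_congr ?_ rfl rfl
      simp only [Fin.val_one, Nat.cast_one]
      constructor <;> intro h <;> linarith
  · refine Finset.sum_congr rfl fun s _ => if_congr ?_ rfl rfl
    simp only [Fin.val_two, Nat.cast_ofNat]
    constructor <;> intro h <;> linarith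

theorem trinomCoeff_neg (k : ℕ) (j : ℤ) : trinomCoeff k (-j) = trinomCoeff k j := by
  induction k generalizing j with
  | zero => simp [trinomCoeff_zero_left]
  | succ k ih =>
    rw [trinomCoeff_succ, trinomCoeff_succ, ← ih (j + 1), ← ih (j - 1), ih j]
    rw [show -j + 1 = -(j - 1) by ring, show -j - 1 = -(j + 1) by ring]
    ring

/-- Comparison of coefficients in the derivative of `P ^ (k + 1)`, for `P = x⁻¹ + 1 + x`. -/
theorem mul_trinomCoeff_succ (k : ℕ) (j : ℤ) :
    (j : ℝ) * trinomCoeff (k + 1) j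
      = (k + 1) * ((trinomCoeff k (j - 1) : ℝ) - trinomCoeff k (j + 1)) := by
  induction k generalizing j with
  | zero =>
    simp only [trinomCoeff_succ, trinomCoeff_zero_left]
    by_cases h0 : j = 0
    · subst h0; norm_num
    by_cases h1 : j = 1
    · subst h1; norm_num
    by_cases h2 : j = -1
    · subst h2; norm_num
    have h3 : j + 1 ≠ 0 := by omega
    have h4 : j - 1 ≠ 0 := by omega
    simp [h0, h3, h4]
  | succ k ih =>
    have e1 := ih (j + 1)
    have e2 := ih j
    have e3 := ih (j - 1)
    have r0 := trinomCoeff_succ (k + 1) j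
    have r1 := trinomCoeff_succ k (j + 1)
    have r3 := trinomCoeff_succ k (j - 1)
    simp only [show j + 1 - 1 = j by ring, show j - 1 + 1 = j by ring] at e1 e3 r1 r3
    have r0' : (trinomCoeff (k + 1 + 1) j : ℝ) = trinomCoeff (k + 1) (j + 1)
      + trinomCoeff (k + 1) j + trinomCoeff (k + 1) (j - 1) := by exact_mod_cast r0
    have r1' : (trinomCoeff (k + 1) (j + 1) : ℝ) = trinomCoeff k (j + 1 + 1)
      + trinomCoeff k (j + 1) + trinomCoeff k j := by exact_mod_cast r1
    have r3' : (trinomCoeff (k + 1) (j - 1) : ℝ) = trinomCoeff k j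
      + trinomCoeff k (j - 1) + trinomCoeff k (j - 1 - 1) := by exact_mod_cast r3
    push_cast at e1 e2 e3 ⊢
    rw [r0']
    linear_combination e1 + e2 + e3 + (k + 1 : ℝ) * r1' - (k + 1 : ℝ) * r3'

theorem trinom_rec (k : ℕ) :
    ((k : ℝ) + 2) * trinom (k + 2) = (2 * k + 3) * trinom (k + 1) + 3 * (k + 1) * trinom k := by
  simp only [← trinomCoeff_zero_right]
  have succ_eq : ∀ m, (trinomCoeff (m + 1) 0 : ℝ) = trinomCoeff m 0 + 2 * trinomCoeff m 1 := by
    intro m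
    rw [trinomCoeff_succ, zero_add, zero_sub, trinomCoeff_neg]
    push_cast
    ring
  have hone : (trinomCoeff (k + 1) 1 : ℝ)
      = trinomCoeff k 2 + trinomCoeff k 1 + trinomCoeff k 0 := by
    rw [trinomCoeff_succ]; norm_num
  have hder := mul_trinomCoeff_succ k 1
  norm_num at hder
  have h1 := succ_eq k
  have h2 := succ_eq (k + 1)
  rw [show k + 2 = k + 1 + 1 from rfl]
  linear_combination (k + 2 : ℝ) * h2 + 2 * hder + 2 * (k + 1 : ℝ) * hone - (k + 1 : ℝ) * h1

theorem trinom_zero : trinom 0 = 1 := by decide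

theorem trinom_one : trinom 1 = 1 := by decide

/-- The probability `t_k / 3^k` that a walk with uniform steps in `{-1,0,1}` is at `0` at
time `k`. -/
noncomputable def returnProb (k : ℕ) : ℝ := trinom k / 3 ^ k

theorem returnProb_rec (k : ℕ) :
    3 * ((k : ℝ) + 2) * returnProb (k + 2)
      = (2 * k + 3) * returnProb (k + 1) + (k + 1) * returnProb k := by
  have h := trinom_rec k
  unfold returnProb
  field_simp
  linear_combination 9 * 3 ^ (k * 2) * h

/-- The normalized central binomial coefficient. -/
noncomputable def centralProb (k : ℕ) : ℝ := (Nat.centralBinom k : ℝ) / 4 ^ k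

theorem centralProb_pos (k : ℕ) : 0 < centralProb k := by
  have := Nat.centralBinom_pos k
  unfold centralProb
  positivity

theorem centralProb_succ (k : ℕ) :
    (2 * (k : ℝ) + 2) * centralProb (k + 1) = (2 * k + 1) * centralProb k := by
  have h : ((k : ℝ) + 1) * Nat.centralBinom (k + 1) = 2 * (2 * k + 1) * Nat.centralBinom k := by
    exact_mod_cast Nat.succ_mul_centralBinom_succ k
  unfold centralProb
  field_simp
  linear_combination 2 * 4 ^ k * h

theorem one_le_mul_centralProb_sq (k : ℕ) : 1 ≤ 4 * ((k : ℝ) + 1) * centralProb (k + 1) ^ 2 := by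
  induction k with
  | zero => norm_num [centralProb, Nat.centralBinom, Nat.choose]
  | succ k ih =>
    have h := centralProb_succ (k + 1)
    push_cast at h ⊢
    have h' : centralProb (k + 1 + 1) = (2 * k + 3) * centralProb (k + 1) / (2 * k + 4) := by
      field_simp
      linear_combination h
    refine ih.trans ?_
    rw [h', div_pow, mul_pow]
    have e : 4 * ((k : ℝ) + 1 + 1) * ((2 * k + 3) ^ 2 * centralProb (k + 1) ^ 2 / (2 * k + 4) ^ 2)
        = (2 * k + 3) ^ 2 / (k + 2) * centralProb (k + 1) ^ 2 := by
      field_simp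
      ring
    rw [e]
    refine mul_le_mul_of_nonneg_right ?_ (sq_nonneg _)
    rw [le_div_iff₀ (by positivity)]
    nlinarith

theorem inv_sqrt_le_centralProb {k : ℕ} (hk : 1 ≤ k) : 1 / (2 * √(k : ℝ)) ≤ centralProb k := by
  obtain ⟨m, rfl⟩ : ∃ m, k = m + 1 := ⟨k - 1, by omega⟩
  have h := one_le_mul_centralProb_sq m
  have hp := centralProb_pos (m + 1)
  have hs : √((m + 1 : ℕ) : ℝ) ^ 2 = m + 1 := by
    rw [Real.sq_sqrt (by positivity)]; push_cast; ring
  have hs0 : 0 < √((m + 1 : ℕ) : ℝ) := Real.sqrt_pos.2 (by positivity)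
  rw [div_le_iff₀ (by positivity)]
  refine (one_le_sq_iff₀ (by positivity)).1 ?_
  rw [mul_pow, mul_pow, hs]
  linarith

theorem two_thirds_centralProb_le_returnProb (k : ℕ) :
    2 / 3 * centralProb k ≤ returnProb k := by
  induction k using Nat.twoStepInduction with
  | zero => norm_num [centralProb, returnProb, trinom_zero]
  | one => norm_num [centralProb, returnProb, trinom_one, Nat.centralBinom, Nat.choose]
  | more k ih0 ih1 =>
    have hr := returnProb_rec k
    have h1 := centralProb_succ k
    have h2 := centralProb_succ (k + 1)
    have hp := centralProb_pos k
    push_cast at h2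
    have e1 : centralProb (k + 1) = (2 * k + 1) * centralProb k / (2 * k + 2) := by
      field_simp; linear_combination h1
    have e2 : centralProb (k + 2)
        = (2 * k + 3) * ((2 * k + 1) * centralProb k / (2 * k + 2)) / (2 * k + 4) := by
      rw [← e1]; field_simp; linear_combination h2
    have key : 3 * ((k : ℝ) + 2) * centralProb (k + 2)
        ≤ (2 * k + 3) * centralProb (k + 1) + (k + 1) * centralProb k := by
      rw [e1, e2, ← sub_nonneg]
      have : (2 * (k : ℝ) + 3) * ((2 * k + 1) * centralProb k / (2 * k + 2))
          + (k + 1) * centralProb k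
          - 3 * ((k : ℝ) + 2) *
            ((2 * k + 3) * ((2 * k + 1) * centralProb k / (2 * k + 2)) / (2 * k + 4))
          = centralProb k / (4 * (k + 1)) := by
        field_simp
        ring
      rw [this]
      positivity
    have i0 := mul_le_mul_of_nonneg_left ih0 (show (0 : ℝ) ≤ k + 1 by positivity)
    have i1 := mul_le_mul_of_nonneg_left ih1 (show (0 : ℝ) ≤ 2 * k + 3 by positivity)
    refine le_of_mul_le_mul_left ?_ (show (0 : ℝ) < 3 * ((k : ℝ) + 2) by positivity)
    linarith

theorem returnProb_le_inv_centralProb (k : ℕ) :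
    returnProb k ≤ 1 / ((2 * k + 1) * centralProb k) := by
  induction k using Nat.twoStepInduction with
  | zero => norm_num [centralProb, returnProb, trinom_zero]
  | one => norm_num [centralProb, returnProb, trinom_one, Nat.centralBinom, Nat.choose]
  | more k ih0 ih1 =>
    have hr := returnProb_rec k
    have h1 := centralProb_succ k
    have h2 := centralProb_succ (k + 1)
    have hp := centralProb_pos k
    push_cast at h2 ih1 ⊢
    have e1 : centralProb (k + 1) = (2 * k + 1) * centralProb k / (2 * k + 2) := by
      field_simp; linear_combination h1
    have e2 : centralProb (k + 2)
        = (2 * k + 3) * ((2 * k + 1) * centralProb k / (2 * k + 2)) / (2 * k + 4) := by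
      rw [← e1]; field_simp; linear_combination h2
    rw [e1] at ih1
    rw [e2]
    have i0 := mul_le_mul_of_nonneg_left ih0 (show (0 : ℝ) ≤ k + 1 by positivity)
    have i1 := mul_le_mul_of_nonneg_left ih1 (show (0 : ℝ) ≤ 2 * k + 3 by positivity)
    refine le_of_mul_le_mul_left ?_ (show (0 : ℝ) < 3 * ((k : ℝ) + 2) by positivity)
    rw [hr]
    refine (add_le_add i1 i0).trans ?_
    rw [← sub_nonneg]
    have : 3 * ((k : ℝ) + 2) * (1 / ((2 * (k + 2) + 1) *
          ((2 * k + 3) * ((2 * k + 1) * centralProb k / (2 * k + 2)) / (2 * k + 4))))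
        - ((2 * k + 3) * (1 / ((2 * (k + 1) + 1) * ((2 * k + 1) * centralProb k / (2 * k + 2))))
          + (k + 1) * (1 / ((2 * k + 1) * centralProb k)))
        = 3 * (k + 1) / ((2 * k + 5) * (2 * k + 3) * (2 * k + 1) * centralProb k) := by
      have a : (2 * ((k : ℝ) + 2) + 1) = 2 * k + 5 := by ring
      have b : (2 * ((k : ℝ) + 1) + 1) = 2 * k + 3 := by ring
      rw [a, b]
      field_simp
      ring
    rw [this]
    positivity

theorem returnProb_le {k : ℕ} (hk : 1 ≤ k) : returnProb k ≤ 1 / √(k : ℝ) := by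
  have hk' : (0 : ℝ) < k := by exact_mod_cast hk
  have hs := Real.sqrt_pos.2 hk'
  have hg := inv_sqrt_le_centralProb hk
  have hp := centralProb_pos k
  refine (returnProb_le_inv_centralProb k).trans (one_div_le_one_div_of_le hs ?_)
  calc √(k : ℝ) = 2 * k * (1 / (2 * √(k : ℝ))) := by
        field_simp
        exact Real.sq_sqrt hk'.le
    _ ≤ 2 * k * centralProb k := by gcongr
    _ ≤ (2 * k + 1) * centralProb k := by gcongr; linarith

theorem le_returnProb {k : ℕ} (hk : 1 ≤ k) : 1 / (3 * √(k : ℝ)) ≤ returnProb k := by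
  have hk' : (0 : ℝ) < k := by exact_mod_cast hk
  have hs := Real.sqrt_pos.2 hk'
  have hg := inv_sqrt_le_centralProb hk
  refine le_trans (le_of_eq ?_)
    ((mul_le_mul_of_nonneg_left hg (by norm_num)).trans (two_thirds_centralProb_le_returnProb k))
  field_simp

theorem sum_inv_sqrt_le (m : ℕ) : ∑ k ∈ Finset.Icc 1 m, 1 / √(k : ℝ) ≤ 2 * √(m : ℝ) := by
  induction m with
  | zero => simp
  | succ m ih =>
    rw [Finset.sum_Icc_succ_top (by omega)]
    have hs : 0 < √((m + 1 : ℕ) : ℝ) := Real.sqrt_pos.2 (by positivity)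
    have e1 : √((m + 1 : ℕ) : ℝ) ^ 2 = m + 1 := by
      rw [Real.sq_sqrt (by positivity)]; push_cast; ring
    have e2 : √(m : ℝ) ^ 2 = m := Real.sq_sqrt (by positivity)
    have : 1 / √((m + 1 : ℕ) : ℝ) ≤ 2 * √((m + 1 : ℕ) : ℝ) - 2 * √(m : ℝ) := by
      rw [div_le_iff₀ hs]
      nlinarith [sq_nonneg (√((m + 1 : ℕ) : ℝ) - √(m : ℝ))]
    linarith

theorem le_sum_sqrt (m : ℕ) : (m : ℝ) * √(m : ℝ) / 2 ≤ ∑ k ∈ Finset.Icc 1 m, √(k : ℝ) := by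
  induction m with
  | zero => simp
  | succ m ih =>
    rw [Finset.sum_Icc_succ_top (by omega)]
    have hs : 0 < √((m + 1 : ℕ) : ℝ) := Real.sqrt_pos.2 (by positivity)
    have e1 : √((m + 1 : ℕ) : ℝ) ^ 2 = m + 1 := by
      rw [Real.sq_sqrt (by positivity)]; push_cast; ring
    have e2 : √(m : ℝ) ^ 2 = m := Real.sq_sqrt (by positivity)
    have h0 := Real.sqrt_nonneg (m : ℝ)
    have hle : √(m : ℝ) ≤ √((m + 1 : ℕ) : ℝ) := Real.sqrt_le_sqrt (by push_cast; linarith)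
    have : (m : ℝ) * (√((m + 1 : ℕ) : ℝ) - √(m : ℝ)) ≤ √((m + 1 : ℕ) : ℝ) := by
      have h1 : (√((m + 1 : ℕ) : ℝ) - √(m : ℝ)) * (√((m + 1 : ℕ) : ℝ) + √(m : ℝ)) = 1 := by
        linear_combination e1 - e2
      have h2 : √((m + 1 : ℕ) : ℝ) * (√((m + 1 : ℕ) : ℝ) - √(m : ℝ)) ≤ 1 := by
        nlinarith [mul_nonneg h0 (sub_nonneg.2 hle)]
      calc (m : ℝ) * (√((m + 1 : ℕ) : ℝ) - √(m : ℝ))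
          ≤ √((m + 1 : ℕ) : ℝ) ^ 2 * (√((m + 1 : ℕ) : ℝ) - √(m : ℝ)) := by
            rw [e1]; exact mul_le_mul_of_nonneg_right (by linarith) (sub_nonneg.2 hle)
        _ = √((m + 1 : ℕ) : ℝ) *
            (√((m + 1 : ℕ) : ℝ) * (√((m + 1 : ℕ) : ℝ) - √(m : ℝ))) := by ring
        _ ≤ √((m + 1 : ℕ) : ℝ) * 1 := mul_le_mul_of_nonneg_left h2 hs.le
        _ = _ := mul_one _
    push_cast at this ih ⊢
    linarith

theorem le_choose_sub (n k : ℕ) (hkn : k ≤ n) (hk : (k : ℝ) ^ 2 ≤ n + 1) :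
    (1 - (k : ℝ) ^ 2 / (n + 1)) * Nat.centralBinom n ≤ Nat.choose (2 * n) (n - k) := by
  induction k with
  | zero => simp [Nat.centralBinom]
  | succ k ih =>
    push_cast at hk ⊢
    have ih' := ih (by omega) (by nlinarith [(Nat.cast_nonneg k : (0 : ℝ) ≤ k)])
    have hkn' : ((k : ℝ) + 1) ≤ n := by exact_mod_cast hkn
    have hstep : (Nat.choose (2 * n) (n - k) : ℝ) * (n - k)
        = Nat.choose (2 * n) (n - (k + 1)) * (n + k + 1) := by
      have h := Nat.choose_succ_right_eq (2 * n) (n - (k + 1))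
      rw [show n - (k + 1) + 1 = n - k by omega,
        show 2 * n - (n - (k + 1)) = n + k + 1 by omega] at h
      have h' : (Nat.choose (2 * n) (n - k) : ℝ) * ((n - k : ℕ) : ℝ)
        = Nat.choose (2 * n) (n - (k + 1)) * ((n + k + 1 : ℕ) : ℝ) := by exact_mod_cast h
      rw [Nat.cast_sub (by omega)] at h'
      push_cast at h'
      exact h'
    have hc : (0 : ℝ) ≤ Nat.centralBinom n := by positivity
    refine le_of_mul_le_mul_right ?_ (show (0 : ℝ) < n + k + 1 by positivity)
    rw [← hstep]
    refine le_trans ?_ (mul_le_mul_of_nonneg_right ih' (by linarith))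
    have key : (1 - ((k : ℝ) + 1) ^ 2 / (n + 1)) * (n + k + 1)
        ≤ (1 - (k : ℝ) ^ 2 / (n + 1)) * (n - k) := by
      rw [← sub_nonneg]
      have : (1 - (k : ℝ) ^ 2 / (n + 1)) * (n - k)
          - (1 - ((k : ℝ) + 1) ^ 2 / (n + 1)) * (n + k + 1)
          = (k ^ 2 * (2 * k + 1) + k * (2 * k + 1)) / (n + 1) := by
        field_simp
        ring
      rw [this]
      positivity
    nlinarith [mul_le_mul_of_nonneg_right key hc]

theorem trinom_mul_pow {n k : ℕ} (h : k ≤ n) :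
    (trinom k : ℝ) * 3 ^ (n - k) = 3 ^ n * returnProb k := by
  unfold returnProb
  rw [pow_sub₀ (3 : ℝ) (by norm_num) h]
  ring

theorem sum_le_of_le {n m : ℕ} (h : m ≤ n) :
    ∑ k ∈ Finset.Icc 1 m,
        (trinom k : ℝ) * (3 : ℝ) ^ (n - k) * (Nat.choose (2 * n) (n - k) : ℝ)
      ≤ 3 ^ n * Nat.centralBinom n * (2 * √(m : ℝ)) := by
  calc _ ≤ ∑ k ∈ Finset.Icc 1 m, 3 ^ n * (Nat.centralBinom n : ℝ) * (1 / √(k : ℝ)) := by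
        refine Finset.sum_le_sum fun k hk => ?_
        rw [Finset.mem_Icc] at hk
        rw [trinom_mul_pow (hk.2.trans h)]
        have h1 := returnProb_le hk.1
        have h2 : (Nat.choose (2 * n) (n - k) : ℝ) ≤ Nat.centralBinom n := by
          exact_mod_cast Nat.choose_le_centralBinom _ _
        calc 3 ^ n * returnProb k * (Nat.choose (2 * n) (n - k) : ℝ)
            ≤ 3 ^ n * (1 / √(k : ℝ)) * Nat.centralBinom n := by gcongr
          _ = _ := by ring
    _ ≤ _ := by
        rw [← Finset.mul_sum]
        exact mul_le_mul_of_nonneg_left (sum_inv_sqrt_le m) (by positivity)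

theorem le_bSeq {n m : ℕ} (h : m ≤ n) (hm : (m : ℝ) ^ 2 ≤ (n + 1) / 2) :
    1 / (n : ℝ) * (3 ^ n * Nat.centralBinom n * ((m : ℝ) * √(m : ℝ) / 12)) ≤ bSeq n := by
  unfold bSeq
  refine mul_le_mul_of_nonneg_left ?_ (by positivity)
  calc 3 ^ n * (Nat.centralBinom n : ℝ) * ((m : ℝ) * √(m : ℝ) / 12)
      = 3 ^ n * (Nat.centralBinom n : ℝ) / 6 * ((m : ℝ) * √(m : ℝ) / 2) := by ring
    _ ≤ 3 ^ n * (Nat.centralBinom n : ℝ) / 6 * ∑ k ∈ Finset.Icc 1 m, √(k : ℝ) :=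
        mul_le_mul_of_nonneg_left (le_sum_sqrt m) (by positivity)
    _ ≤ ∑ k ∈ Finset.Icc 1 m, (k : ℝ) * (trinom k : ℝ) * (3 : ℝ) ^ (n - k) *
          (Nat.choose (2 * n) (n - k) : ℝ) := by
        rw [Finset.mul_sum]
        refine Finset.sum_le_sum fun k hk => ?_
        rw [Finset.mem_Icc] at hk
        rw [mul_assoc (k : ℝ), trinom_mul_pow (hk.2.trans h)]
        have hk' : (0 : ℝ) < k := by exact_mod_cast hk.1
        have hs := Real.sqrt_pos.2 hk'
        have hkm : (k : ℝ) ^ 2 ≤ (n + 1) / 2 := by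
          have : (k : ℝ) ≤ m := by exact_mod_cast hk.2
          nlinarith
        have hc : (Nat.centralBinom n : ℝ) / 2 ≤ Nat.choose (2 * n) (n - k) := by
          refine le_trans ?_ (le_choose_sub n k (hk.2.trans h) (by linarith))
          have : (k : ℝ) ^ 2 / (n + 1) ≤ 1 / 2 := by
            rw [div_le_iff₀ (by positivity)]; linarith
          have hc0 : (0 : ℝ) ≤ Nat.centralBinom n := by positivity
          nlinarith
        calc 3 ^ n * (Nat.centralBinom n : ℝ) / 6 * √(k : ℝ)
            = k * (3 ^ n * (1 / (3 * √(k : ℝ)))) * (Nat.centralBinom n / 2) := by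
              field_simp
              rw [Real.sq_sqrt hk'.le]
              ring
          _ ≤ k * (3 ^ n * returnProb k) * (Nat.choose (2 * n) (n - k) : ℝ) := by
              have := le_returnProb hk.1
              have h0 : 0 ≤ returnProb k := le_trans (by positivity) this
              gcongr
    _ ≤ _ := by
        refine Finset.sum_le_sum_of_subset_of_nonneg (Finset.Icc_subset_Icc_right h) ?_
        intros
        positivity

theorem exists_nat_sqrt_le (n : ℕ) (hn : 1 ≤ n) :
    ∃ m : ℕ, m ≤ n ∧ (m : ℝ) ^ 2 ≤ (n + 1) / 2 ∧ √(2 * n) / 4 ≤ m := by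
  have hn' : (1 : ℝ) ≤ n := by exact_mod_cast hn
  set r := √(((n : ℝ) + 1) / 2) with hr
  have hr2 : r ^ 2 = (n + 1) / 2 := Real.sq_sqrt (by positivity)
  have hr0 : 0 ≤ r := Real.sqrt_nonneg _
  have hr1 : 1 ≤ r := by nlinarith
  have hm1 : ((⌊r⌋₊ : ℕ) : ℝ) ≤ r := Nat.floor_le hr0
  have hm2 : r < ⌊r⌋₊ + 1 := Nat.lt_floor_add_one r
  have hm3 : (1 : ℝ) ≤ ⌊r⌋₊ := by exact_mod_cast (Nat.one_le_floor_iff r).2 hr1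
  refine ⟨⌊r⌋₊, ?_, by nlinarith, ?_⟩
  · have : ((⌊r⌋₊ : ℕ) : ℝ) ≤ n := by nlinarith
    exact_mod_cast this
  · have : √(2 * (n : ℝ)) ≤ 2 * r := Real.sqrt_le_iff.2 ⟨by positivity, by nlinarith⟩
    linarith

/-- Uniform integrability of `√(2n)/L_n^•`: for every `δ > 0` there is `M > 0`
such that for all `n ≥ 1`,
`2 ∑_{k=1}^{⌊√(2n)/M⌋} t_k 3^{n-k} C(2n, n-k) ≤ δ √(2n) b_n`. -/
theorem uniform_integrability_inverse_length (δ : ℝ) (hδ : 0 < δ) :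
    ∃ M : ℝ, 0 < M ∧ ∀ n : ℕ, 1 ≤ n →
      2 * ∑ k ∈ Finset.Icc 1 ⌊Real.sqrt (2 * n) / M⌋₊,
          (trinom k : ℝ) * (3 : ℝ) ^ (n - k) * (Nat.choose (2 * n) (n - k) : ℝ) ≤
        δ * Real.sqrt (2 * n) * bSeq n := by
  have hM0 : (0 : ℝ) < 2 + (192 / δ) ^ 2 := by positivity
  refine ⟨2 + (192 / δ) ^ 2, hM0, fun n hn => ?_⟩
  set M : ℝ := 2 + (192 / δ) ^ 2 with hM
  have hn' : (1 : ℝ) ≤ n := by exact_mod_cast hn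
  set s : ℝ := √(2 * (n : ℝ)) with hs
  have hs2 : s ^ 2 = 2 * n := Real.sq_sqrt (by positivity)
  have hs0 : 0 < s := Real.sqrt_pos.2 (by positivity)
  have hfloor : ((⌊s / M⌋₊ : ℕ) : ℝ) ≤ s / M := Nat.floor_le (by positivity)
  have hfn : ⌊s / M⌋₊ ≤ n := by
    have h2 : s / M ≤ s / 2 :=
      div_le_div_of_nonneg_left hs0.le (by norm_num) (by rw [hM]; linarith [sq_nonneg (192 / δ)])
    have : ((⌊s / M⌋₊ : ℕ) : ℝ) ≤ n := by nlinarith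
    exact_mod_cast this
  obtain ⟨m, hmn, hm2, hms⟩ := exists_nat_sqrt_le n hn
  have hup := sum_le_of_le hfn
  have hlow := le_bSeq hmn hm2
  set D : ℝ := 3 ^ n * (Nat.centralBinom n : ℝ) with hD
  have hD0 : 0 ≤ D := by positivity
  have hss : 0 < √s := Real.sqrt_pos.2 hs0
  have hsqM : 192 / δ ≤ √M := Real.le_sqrt_of_sq_le (by rw [hM]; linarith)
  have hsqM0 : 0 < √M := Real.sqrt_pos.2 hM0
  have h1 : √((⌊s / M⌋₊ : ℕ) : ℝ) ≤ √s / √M := by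
    rw [← Real.sqrt_div hs0.le]
    exact Real.sqrt_le_sqrt hfloor
  have h2 : √s / √M ≤ δ * √s / 192 := by
    rw [div_le_iff₀ hδ] at hsqM
    rw [div_le_div_iff₀ hsqM0 (by norm_num)]
    nlinarith
  have h3 : s / 4 * (√s / 2) ≤ m * √(m : ℝ) := by
    have : √s / 2 ≤ √(m : ℝ) := by
      refine Real.le_sqrt_of_sq_le ?_
      rw [div_pow, Real.sq_sqrt hs0.le]
      linarith
    gcongr
  calc _ ≤ 2 * (D * (2 * (δ * √s / 192))) := by
        refine mul_le_mul_of_nonneg_left (hup.trans ?_) (by norm_num)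
        gcongr
        exact h1.trans h2
    _ = δ * s * (1 / (n : ℝ) * (D * (s / 4 * (√s / 2) / 12))) := by
        field_simp
        rw [hs2]
        ring
    _ ≤ δ * s * (1 / (n : ℝ) * (D * (m * √(m : ℝ) / 12))) := by gcongr
    _ ≤ δ * s * bSeq n := by gcongr
end

section
/- For all λ₁ > 0 and λ₂ > 0, ∫_{0}^{∞} (1/(2·√(2π·x³)))·(1 − exp(−x·(√(2λ₁)+√(2λ₂)))) dx = 2^{−1/4}·(√λ₁ + √λ₂)^{1/2}. (This computes the joint Laplace transform of the volumes of the two delayed Voronoï cells under the free biased Brownian sphere measure: 𝕌(1 − exp(−λ₁σ₁ − λ₂σ₂)) = 2^{−1/4}(√λ₁+√λ₂)^{1/2}.) -/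
open MeasureTheory Set Filter Topology

/-- The kernel `x ^ (-3/2) * (1 - exp (-(c x)))` is integrable on the positive half-line. -/
lemma integrableOn_rpow_mul_one_sub_exp {c : ℝ} (hc : 0 < c) :
    IntegrableOn (fun x : ℝ => x ^ (-(3 / 2) : ℝ) * (1 - Real.exp (-(c * x)))) (Ioi 0) := by
  have hmeas : Measurable (fun x : ℝ => x ^ (-(3 / 2) : ℝ) * (1 - Real.exp (-(c * x)))) := by
    fun_prop
  rw [← Ioc_union_Ioi_eq_Ioi (zero_le_one (α := ℝ))]
  refine IntegrableOn.union ?_ ?_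
  · have hdom : IntegrableOn (fun x : ℝ => c * x ^ (-(1 / 2) : ℝ)) (Ioc 0 1) :=
      ((intervalIntegrable_iff_integrableOn_Ioc_of_le zero_le_one).1
        (intervalIntegral.intervalIntegrable_rpow' (by norm_num))).const_mul c
    refine Integrable.mono' hdom hmeas.aestronglyMeasurable ?_
    refine (ae_restrict_iff' measurableSet_Ioc).2 (Eventually.of_forall fun x hx => ?_)
    have hx0 : 0 < x := hx.1
    have hle : 1 - Real.exp (-(c * x)) ≤ c * x := by
      linarith [Real.add_one_le_exp (-(c * x))]
    have hnn : 0 ≤ 1 - Real.exp (-(c * x)) := by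
      have : Real.exp (-(c * x)) ≤ 1 := Real.exp_le_one_iff.2 (by nlinarith)
      linarith
    have hpow : x ^ (-(1 / 2) : ℝ) = x ^ (-(3 / 2) : ℝ) * x := by
      rw [← Real.rpow_add_one hx0.ne']
      norm_num
    rw [Real.norm_of_nonneg (by positivity), hpow]
    calc _ ≤ x ^ (-(3 / 2) : ℝ) * (c * x) := by gcongr
      _ = _ := by ring
  · have hdom : IntegrableOn (fun x : ℝ => x ^ (-(3 / 2) : ℝ)) (Ioi 1) :=
      integrableOn_Ioi_rpow_of_lt (by norm_num) one_pos
    refine Integrable.mono' hdom hmeas.aestronglyMeasurable ?_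
    refine (ae_restrict_iff' measurableSet_Ioi).2 (Eventually.of_forall fun x hx => ?_)
    have hx0 : 0 < x := one_pos.trans hx
    have hnn : 0 ≤ 1 - Real.exp (-(c * x)) := by
      have : Real.exp (-(c * x)) ≤ 1 := Real.exp_le_one_iff.2 (by nlinarith)
      linarith
    rw [Real.norm_of_nonneg (by positivity)]
    exact mul_le_of_le_one_right (by positivity) (by linarith [Real.exp_pos (-(c * x))])

/-- The Lévy–Khintchine integral of the stable subordinator of index `1/2`. -/
lemma integral_rpow_mul_one_sub_exp {c : ℝ} (hc : 0 < c) :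
    ∫ x in Ioi (0 : ℝ), x ^ (-(3 / 2) : ℝ) * (1 - Real.exp (-(c * x))) =
      2 * Real.sqrt (Real.pi * c) := by
  have hg := integrableOn_rpow_mul_one_sub_exp hc
  have hh : IntegrableOn
      (fun x : ℝ => 2 * c * (x ^ ((1 / 2 : ℝ) - 1) * Real.exp (-(c * x)))) (Ioi 0) := by
    have := integrableOn_rpow_mul_exp_neg_mul_rpow (s := (1 / 2 : ℝ) - 1) (p := 1) (b := c)
      (by norm_num) one_pos hc
    simp only [Real.rpow_one, neg_mul] at this
    exact this.const_mul (2 * c)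
  have hderiv : ∀ x ∈ Ioi (0 : ℝ),
      HasDerivAt (fun x : ℝ => -2 * (x ^ (-(1 / 2) : ℝ) * (1 - Real.exp (-(c * x)))))
        (x ^ (-(3 / 2) : ℝ) * (1 - Real.exp (-(c * x))) -
          2 * c * (x ^ ((1 / 2 : ℝ) - 1) * Real.exp (-(c * x)))) x := by
    intro x hx
    have h1 := Real.hasDerivAt_rpow_const (x := x) (p := -(1 / 2)) (Or.inl (ne_of_gt hx))
    have h2 : HasDerivAt (fun x : ℝ => 1 - Real.exp (-(c * x)))
        (c * Real.exp (-(c * x))) x := by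
      have := ((((hasDerivAt_id x).const_mul c).neg).exp).const_sub 1
      refine this.congr_deriv ?_
      simp only [id, Pi.neg_apply]
      ring
    refine ((h1.mul h2).const_mul (-2)).congr_deriv ?_
    norm_num
    ring
  have hbound : ∀ x : ℝ, 0 ≤ x → 0 ≤ 1 - Real.exp (-(c * x)) := fun x hx => by
    have : Real.exp (-(c * x)) ≤ 1 := Real.exp_le_one_iff.2 (by nlinarith)
    linarith
  have hzero : Tendsto (fun x : ℝ => x ^ (-(1 / 2) : ℝ) * (1 - Real.exp (-(c * x))))
      (𝓝[>] 0) (𝓝 0) := by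
    have hlim : Tendsto (fun x : ℝ => c * x ^ (1 / 2 : ℝ)) (𝓝[>] 0) (𝓝 0) := by
      have : Continuous fun x : ℝ => c * x ^ (1 / 2 : ℝ) :=
        continuous_const.mul (Real.continuous_rpow_const (by norm_num))
      simpa using (this.tendsto 0).mono_left nhdsWithin_le_nhds
    refine squeeze_zero' ?_ ?_ hlim
    · filter_upwards [self_mem_nhdsWithin] with x hx
      exact mul_nonneg (Real.rpow_nonneg (le_of_lt hx) _) (hbound x (le_of_lt hx))
    · filter_upwards [self_mem_nhdsWithin] with x hx
      have hx0 : 0 < x := hx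
      have hpow : x ^ (1 / 2 : ℝ) = x ^ (-(1 / 2) : ℝ) * x := by
        rw [← Real.rpow_add_one hx0.ne']
        norm_num
      have hle : 1 - Real.exp (-(c * x)) ≤ c * x := by
        linarith [Real.add_one_le_exp (-(c * x))]
      rw [hpow]
      calc _ ≤ x ^ (-(1 / 2) : ℝ) * (c * x) := by gcongr
        _ = _ := by ring
  have htop : Tendsto (fun x : ℝ => x ^ (-(1 / 2) : ℝ) * (1 - Real.exp (-(c * x))))
      atTop (𝓝 0) := by
    refine squeeze_zero' ?_ ?_ (tendsto_rpow_neg_atTop (y := 1 / 2) (by norm_num))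
    · filter_upwards [eventually_gt_atTop 0] with x hx
      exact mul_nonneg (Real.rpow_nonneg hx.le _) (hbound x hx.le)
    · filter_upwards [eventually_gt_atTop 0] with x hx
      exact mul_le_of_le_one_right (Real.rpow_nonneg hx.le _)
        (by linarith [Real.exp_pos (-(c * x))])
  have hcont : ContinuousWithinAt
      (fun x : ℝ => -2 * (x ^ (-(1 / 2) : ℝ) * (1 - Real.exp (-(c * x))))) (Ici 0) 0 := by
    rw [← continuousWithinAt_Ioi_iff_Ici, ContinuousWithinAt]
    simpa using hzero.const_mul (-2)
  have hftc := integral_Ioi_of_hasDerivAt_of_tendsto hcont hderiv (hg.sub hh)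
    (htop.const_mul (-2))
  simp only [mul_zero, neg_zero, Real.exp_zero, sub_self] at hftc
  rw [integral_sub hg hh, integral_const_mul,
    Real.integral_rpow_mul_exp_neg_mul_Ioi (by norm_num) hc, Real.Gamma_one_half_eq,
    ← Real.sqrt_eq_rpow] at hftc
  have hval : c * (Real.sqrt (1 / c) * Real.sqrt Real.pi) = Real.sqrt (Real.pi * c) := by
    rw [Real.sqrt_mul Real.pi_pos.le, one_div, Real.sqrt_inv]
    have := Real.sq_sqrt hc.le
    have := (Real.sqrt_pos.2 hc).ne'
    field_simp
    nlinarith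
  linarith

/-- The joint Laplace transform of the volumes of the two delayed Voronoï cells
under the free biased Brownian sphere measure:
`∫_0^∞ (1/(2√(2πx³))) (1 - exp(-x(√(2λ₁)+√(2λ₂)))) dx = 2^{-1/4} (√λ₁+√λ₂)^{1/2}`. -/
theorem laplace_transform_volumes (l1 l2 : ℝ) (h1 : 0 < l1) (h2 : 0 < l2) :
    (∫ x in Set.Ioi (0 : ℝ),
        (1 / (2 * Real.sqrt (2 * Real.pi * x ^ 3))) *
          (1 - Real.exp (-(x * (Real.sqrt (2 * l1) + Real.sqrt (2 * l2)))))) =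
      (2 : ℝ) ^ (-(1 : ℝ) / 4) * (Real.sqrt l1 + Real.sqrt l2) ^ ((1 : ℝ) / 2) := by
  set s := Real.sqrt l1 + Real.sqrt l2 with hs
  have hspos : 0 < s := add_pos (Real.sqrt_pos.2 h1) (Real.sqrt_pos.2 h2)
  have hsum : Real.sqrt (2 * l1) + Real.sqrt (2 * l2) = Real.sqrt 2 * s := by
    rw [Real.sqrt_mul zero_le_two, Real.sqrt_mul zero_le_two, hs, mul_add]
  have hc : 0 < Real.sqrt 2 * s := by positivity
  have hkernel : ∀ x ∈ Ioi (0 : ℝ),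
      (1 / (2 * Real.sqrt (2 * Real.pi * x ^ 3))) *
          (1 - Real.exp (-(x * (Real.sqrt (2 * l1) + Real.sqrt (2 * l2))))) =
        (1 / (2 * Real.sqrt (2 * Real.pi))) *
          (x ^ (-(3 / 2) : ℝ) * (1 - Real.exp (-(Real.sqrt 2 * s * x)))) := by
    intro x hx
    have hx0 : 0 < x := hx
    have hpow : x ^ (-(3 / 2) : ℝ) = (Real.sqrt (x ^ 3))⁻¹ := by
      rw [Real.rpow_neg hx0.le, Real.sqrt_eq_rpow, ← Real.rpow_natCast, ← Real.rpow_mul hx0.le]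
      norm_num
    rw [hsum, Real.sqrt_mul (by positivity), hpow, mul_comm x]
    field_simp
  rw [setIntegral_congr_fun measurableSet_Ioi hkernel, integral_const_mul,
    integral_rpow_mul_one_sub_exp hc, Real.sqrt_mul Real.pi_pos.le,
    Real.sqrt_mul zero_le_two, Real.sqrt_mul (Real.sqrt_nonneg 2), ← Real.sqrt_eq_rpow]
  have hpow : (2 : ℝ) ^ (-(1 : ℝ) / 4) * Real.sqrt 2 = Real.sqrt (Real.sqrt 2) := by
    rw [Real.sqrt_eq_rpow, Real.sqrt_eq_rpow, ← Real.rpow_mul zero_le_two,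
      ← Real.rpow_add zero_lt_two]
    norm_num
  rw [← hpow]
  have := (Real.sqrt_pos.2 Real.pi_pos).ne'
  field_simp
end

section
/- Let a > 0 and let f, g : [0,a] → ℝ be continuous with f ≥ 0 and f(0) = f(a) = 0, and assume that for all s, t ∈ [0,a], d_f(s,t) = 0 implies d_g(s,t) = 0. Define D_{f,g}(s,t) = inf { ∑_{i=0}^{n} d_g(s_i, t_i) }, the infimum over all n ∈ ℕ and sequences s_0, t_0, s_1, t_1, …, s_n, t_n ∈ [0,a] with s_0 = s, t_n = t and d_f(t_i, s_{i+1}) = 0 for every 0 ≤ i ≤ n−1. Then for all s, t ∈ [0,a], D_{f,g}(s,t) ≥ |g(s) − g(t)|. -/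
/-- `m_h(s,t)`: the infimum of `h` over the arc from `s` to `t` in `[0,a]` viewed
as a circle: over `[s,t]` if `s ≤ t`, and over `[0,t] ∪ [s,a]` if `s ≥ t`. -/
noncomputable def mArc (a : ℝ) (h : ℝ → ℝ) (s t : ℝ) : ℝ :=
  if s ≤ t then sInf (h '' Set.Icc s t)
  else sInf (h '' (Set.Icc 0 t ∪ Set.Icc s a))

/-- `d_h(s,t) = h(s) + h(t) - 2 max(m_h(s,t), m_h(t,s))`. -/
noncomputable def dArc (a : ℝ) (h : ℝ → ℝ) (s t : ℝ) : ℝ :=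
  h s + h t - 2 * max (mArc a h s t) (mArc a h t s)

/-- The pseudo-distance `D_{f,g}(s,t)`: the infimum of `∑_{i=0}^{n} d_g(s_i, t_i)`
over all chains `s_0, t_0, …, s_n, t_n ∈ [0,a]` with `s_0 = s`, `t_n = t`, and
`d_f(t_i, s_{i+1}) = 0` for `0 ≤ i ≤ n-1`. -/
noncomputable def Dfg (a : ℝ) (f g : ℝ → ℝ) (s t : ℝ) : ℝ :=
  sInf { x : ℝ | ∃ (n : ℕ) (p q : Fin (n + 1) → ℝ),
    (∀ i, p i ∈ Set.Icc 0 a) ∧ (∀ i, q i ∈ Set.Icc 0 a) ∧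
    p 0 = s ∧ q (Fin.last n) = t ∧
    (∀ i : Fin n, dArc a f (q i.castSucc) (p i.succ) = 0) ∧
    x = ∑ i, dArc a g (p i) (q i) }

/-- The arc infimum is at most the value at either endpoint. -/
theorem mArc_le_min {a : ℝ} {h : ℝ → ℝ} (hb : BddBelow (h '' Set.Icc 0 a)) {s t : ℝ}
    (hs : s ∈ Set.Icc 0 a) (ht : t ∈ Set.Icc 0 a) : mArc a h s t ≤ min (h s) (h t) := by
  unfold mArc
  split_ifs with hst
  · have hb' : BddBelow (h '' Set.Icc s t) :=
      hb.mono (Set.image_mono (Set.Icc_subset_Icc hs.1 ht.2))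
    exact le_min (csInf_le hb' ⟨s, ⟨le_rfl, hst⟩, rfl⟩) (csInf_le hb' ⟨t, ⟨hst, le_rfl⟩, rfl⟩)
  · have hb' : BddBelow (h '' (Set.Icc 0 t ∪ Set.Icc s a)) :=
      hb.mono (Set.image_mono (Set.union_subset (Set.Icc_subset_Icc le_rfl ht.2)
        (Set.Icc_subset_Icc hs.1 le_rfl)))
    exact le_min (csInf_le hb' ⟨s, Or.inr ⟨le_rfl, hs.2⟩, rfl⟩)
      (csInf_le hb' ⟨t, Or.inl ⟨ht.1, le_rfl⟩, rfl⟩)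

/-- A function is 1-Lipschitz for its own tree pseudo-distance. -/
theorem abs_sub_le_dArc {a : ℝ} {h : ℝ → ℝ} (hb : BddBelow (h '' Set.Icc 0 a)) {s t : ℝ}
    (hs : s ∈ Set.Icc 0 a) (ht : t ∈ Set.Icc 0 a) : |h s - h t| ≤ dArc a h s t := by
  have hmax : max (mArc a h s t) (mArc a h t s) ≤ min (h s) (h t) :=
    max_le (mArc_le_min hb hs ht) ((mArc_le_min hb ht hs).trans_eq (min_comm _ _))
  have hl := hmax.trans (min_le_left _ _)
  have hr := hmax.trans (min_le_right _ _)
  unfold dArc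
  rw [abs_le]
  constructor <;> linarith

/-- Along a chain whose jumps preserve `g`, the variation of `g` is controlled by the steps. -/
theorem abs_sub_le_sum_chain {α : Type*} (g : α → ℝ) (d : α → α → ℝ) (n : ℕ)
    (p q : Fin (n + 1) → α) (hd : ∀ i, |g (p i) - g (q i)| ≤ d (p i) (q i))
    (hj : ∀ i : Fin n, g (q i.castSucc) = g (p i.succ)) :
    |g (p 0) - g (q (Fin.last n))| ≤ ∑ i, d (p i) (q i) := by
  induction n with
  | zero => simpa using hd 0
  | succ n ih =>
    have hprefix := ih (fun i => p i.castSucc) (fun i => q i.castSucc) (fun i => hd _)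
      (fun i => hj i.castSucc)
    have hjump := hj (Fin.last n)
    have hlast := hd (Fin.last (n + 1))
    rw [Fin.sum_univ_castSucc]
    rw [hjump, Fin.succ_last, Fin.castSucc_zero] at hprefix
    exact (abs_sub_le _ _ _).trans (add_le_add hprefix hlast)

/-- The cactus bound: `D_{f,g}(s,t) ≥ |g(s) - g(t)|` for all `s, t ∈ [0,a]`. -/
theorem cactus_bound (a : ℝ) (ha : 0 < a) (f g : ℝ → ℝ)
    (hf : ContinuousOn f (Set.Icc 0 a)) (hg : ContinuousOn g (Set.Icc 0 a))
    (hf_nonneg : ∀ s ∈ Set.Icc (0 : ℝ) a, 0 ≤ f s)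
    (hf0 : f 0 = 0) (hfa : f a = 0)
    (hfg : ∀ s ∈ Set.Icc (0 : ℝ) a, ∀ t ∈ Set.Icc (0 : ℝ) a,
      dArc a f s t = 0 → dArc a g s t = 0) :
    ∀ s ∈ Set.Icc (0 : ℝ) a, ∀ t ∈ Set.Icc (0 : ℝ) a,
      |g s - g t| ≤ Dfg a f g s t := by
  intro s hs t ht
  have hb : BddBelow (g '' Set.Icc 0 a) := (isCompact_Icc.image_of_continuousOn hg).bddBelow
  refine le_csInf ⟨_, 0, fun _ => s, fun _ => t, fun _ => hs, fun _ => ht, rfl, rfl,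
    fun i => i.elim0, rfl⟩ ?_
  rintro x ⟨n, p, q, hp, hq, rfl, rfl, hjump, rfl⟩
  refine abs_sub_le_sum_chain g (dArc a g) n p q
    (fun i => abs_sub_le_dArc hb (hp i) (hq i)) (fun i => ?_)
  have hdist := abs_sub_le_dArc hb (hq i.castSucc) (hp i.succ)
  rw [hfg _ (hq _) _ (hp _) (hjump i)] at hdist
  exact sub_eq_zero.mp (abs_nonpos_iff.mp hdist)
end
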